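/- Let 2 ≤ p ∈ ℕ ∪ {∞}. A continuous function f : ∂𝔻 × 𝔻 → ℂ which is positive definite on Ω₂ × Ω_{2p}, written in its expansion f(ξ,η) = Σ_{m∈ℤ, k,l∈ℤ₊} a_{m,k,l} ξ^m R_{k,l}^{p−2}(η) with all a_{m,k,l} ≥ 0 and Σ a_{m,k,l} < ∞, is strictly positive definite on Ω₂ × Ω_{2p} if, and only if, the set {(m, k−l) ∈ ℤ² : a_{m,k,l} > 0} intersects every product of full arithmetic progressions in ℤ. -/

import Mathlib

open scoped ComplexOrder

noncomputable section

/-- The Hilbert space ℓ²(ℂ) of square–summable complex sequences. -/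
abbrev Ell2 : Type := lp (fun _ : ℕ => ℂ) 2

/-- The Hermitian inner product of the paper: `hdot z w = z·w = Σ_j z_j conj(w_j)`. -/
def hdot (z w : Ell2) : ℂ := @inner ℂ _ _ w z

/-- The sphere `Ω_{2q}` (for `q : ℕ∞`), viewed inside ℓ²(ℂ): the unit vectors supported
on the first `q` coordinates; for `q = ⊤` this is the unit sphere `Ω_∞` of ℓ²(ℂ). -/
def Omega (q : ℕ∞) : Set Ell2 :=
  {z | ‖z‖ = 1 ∧ ∀ j : ℕ, q ≤ (j : ℕ∞) → z j = 0}

/-- A kernel `K` is positive definite on a set `S`. -/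
def IsPDKernel {α : Type*} (S : Set α) (K : α → α → ℂ) : Prop :=
  ∀ (L : ℕ) (x : Fin L → α), (∀ i, x i ∈ S) → Function.Injective x →
    ∀ c : Fin L → ℂ, 0 ≤ ∑ μ, ∑ ν, c μ * (starRingEnd ℂ) (c ν) * K (x μ) (x ν)

/-- A kernel `K` is strictly positive definite on a set `S`. -/
def IsSPDKernel {α : Type*} (S : Set α) (K : α → α → ℂ) : Prop :=
  IsPDKernel S K ∧
    ∀ (L : ℕ) (x : Fin L → α), (∀ i, x i ∈ S) → Function.Injective x →
      ∀ c : Fin L → ℂ,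
        ∑ μ, ∑ ν, c μ * (starRingEnd ℂ) (c ν) * K (x μ) (x ν) = 0 → c = 0

/-- `f` is positive definite on `Ω_{2q} × Ω_{2p}`. -/
def PDonProd (q p : ℕ∞) (f : ℂ → ℂ → ℂ) : Prop :=
  IsPDKernel ((Omega q) ×ˢ (Omega p))
    (fun x y => f (hdot x.1 y.1) (hdot x.2 y.2))

/-- `f` is strictly positive definite on `Ω_{2q} × Ω_{2p}`. -/
def SPDonProd (q p : ℕ∞) (f : ℂ → ℂ → ℂ) : Prop :=
  IsSPDKernel ((Omega q) ×ˢ (Omega p))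
    (fun x y => f (hdot x.1 y.1) (hdot x.2 y.2))

/-- `g` is positive definite on `Ω_{2q}`. -/
def PDonSphere (q : ℕ∞) (g : ℂ → ℂ) : Prop :=
  IsPDKernel (Omega q) (fun z z' => g (hdot z z'))

/-- The Jacobi polynomial of degree `k` with (integer) parameters `α, β`, normalized
so that its value at `1` is `1`. -/
def jacobiR (α β k : ℕ) (x : ℝ) : ℝ :=
  (∑ s ∈ Finset.range (k + 1),
      ((k + α).choose (k - s) : ℝ) * ((k + β).choose s : ℝ) *
        ((x - 1) / 2) ^ s * ((x + 1) / 2) ^ (k - s)) /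
    ((k + α).choose k : ℝ)

/-- The disc polynomial `R_{m,n}^{q-2}`; for `q = ⊤` (and also `q = 1`) it is
`ξ^m conj(ξ)^n`.  For `2 ≤ q < ⊤` it equals
`r^{|m-n|} e^{i(m-n)φ} R_{min(m,n)}^{(q-2,|m-n|)}(2r²-1)` for `ξ = r e^{iφ}`. -/
def discR (q : ℕ∞) (m n : ℕ) (ξ : ℂ) : ℂ :=
  if q = ⊤ ∨ q ≤ 1 then ξ ^ m * (starRingEnd ℂ ξ) ^ n
  else (if n ≤ m then ξ ^ (m - n) else (starRingEnd ℂ ξ) ^ (n - m)) *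
    ((jacobiR (q.toNat - 2) (max m n - min m n) (min m n)
        (2 * ‖ξ‖ ^ 2 - 1) : ℝ) : ℂ)

/-- The natural domain `𝔻̃`: the unit circle `∂𝔻` when `q = 1` (the sphere `Ω₂`),
the closed unit disc `𝔻` otherwise. -/
def domD (q : ℕ∞) : Set ℂ :=
  if q = 1 then Metric.sphere (0 : ℂ) 1 else Metric.closedBall (0 : ℂ) 1

/-- `A ⊆ ℤ²` intersects every product of full arithmetic progressions in ℤ. -/
def MeetsAllProgressions (A : Set (ℤ × ℤ)) : Prop :=
  ∀ N M x y : ℤ, 0 < N → 0 < M → 0 < x → 0 < y →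
    ∃ v ∈ A, (∃ j : ℤ, v.1 = N * j + x) ∧ (∃ j : ℤ, v.2 = M * j + y)

/-! ### Rotated monomials and the Bombieri norm -/

open Polynomial in
/-- The polynomial `(rX + s)^k (r - sX)^l`, a dehomogenized rotated monomial. -/
def rotPoly (r s : ℝ) (k l : ℕ) : ℝ[X] := (C r * X + C s) ^ k * (C (-s) * X + C r) ^ l

open Polynomial in
/-- The Bombieri form on polynomials of degree at most `N`. -/
def bombieri (N : ℕ) (P Q : ℝ[X]) : ℝ :=
  ∑ j ∈ Finset.range (N + 1), (j.factorial : ℝ) * ((N - j).factorial : ℝ) * (P.coeff j * Q.coeff j)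

open Polynomial in
lemma bombieri_linear_mul (N : ℕ) (a b : ℝ) (P Q : ℝ[X]) (hP : P.natDegree ≤ N) :
    bombieri (N + 1) ((C a * X + C b) * P) Q =
      bombieri N P (C a * derivative Q + C b * (C ((N : ℝ) + 1) * Q - X * derivative Q)) := by
  have hc : ∀ j, ((C a * X + C b) * P).coeff j = a * (X * P).coeff j + b * P.coeff j := by
    intro j; rw [add_mul, coeff_add, mul_assoc, coeff_C_mul, coeff_C_mul]
  have hx : ∀ j, (X * derivative Q).coeff j = j * Q.coeff j := by
    intro j
    cases j with
    | zero => simp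
    | succ j => rw [coeff_X_mul, coeff_derivative]; push_cast; ring
  have hd : ∀ j, (C a * derivative Q + C b * (C ((N : ℝ) + 1) * Q - X * derivative Q)).coeff j =
      a * ((j + 1) * Q.coeff (j + 1)) + b * (((N : ℝ) + 1 - j) * Q.coeff j) := by
    intro j
    rw [coeff_add, coeff_C_mul, coeff_C_mul, coeff_sub, coeff_C_mul, hx, coeff_derivative]; ring
  have hN : P.coeff (N + 1) = 0 := coeff_eq_zero_of_natDegree_lt (by omega)
  unfold bombieri
  simp only [hc, hd]
  have e1 : ∀ u v x y z : ℝ, u * v * ((x + y) * z) = u * v * (x * z) + u * v * (y * z) := by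
    intros; ring
  have e2 : ∀ u v x y z : ℝ, u * v * (x * (y + z)) = u * v * (x * y) + u * v * (x * z) := by
    intros; ring
  simp only [e1, e2, Finset.sum_add_distrib]
  congr 1
  · rw [Finset.sum_range_succ']
    simp only [coeff_X_mul, mul_coeff_zero, coeff_X_zero, zero_mul, mul_zero, add_zero]
    refine Finset.sum_congr rfl fun j hj => ?_
    rw [show N + 1 - (j + 1) = N - j by omega, Nat.factorial_succ]
    push_cast; ring
  · rw [Finset.sum_range_succ, hN]
    simp only [mul_zero, zero_mul, add_zero]
    refine Finset.sum_congr rfl fun j hj => ?_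
    have hj' : j ≤ N := by simpa [Nat.lt_succ_iff] using hj
    rw [show N + 1 - j = (N - j) + 1 by omega, Nat.factorial_succ]
    push_cast [Nat.cast_sub hj']; ring

open Polynomial in
lemma natDegree_rotPoly_le (r s : ℝ) (k l : ℕ) : (rotPoly r s k l).natDegree ≤ k + l := by
  unfold rotPoly
  refine natDegree_mul_le_of_le ?_ ?_
  · simpa using natDegree_pow_le_of_le k (natDegree_linear_le (a := r) (b := s))
  · simpa using natDegree_pow_le_of_le l (natDegree_linear_le (a := -s) (b := r))

open Polynomial in
lemma linear_mul_derivative_pow (a b : ℝ) (n : ℕ) :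
    (C a * X + C b) * derivative ((C a * X + C b) ^ n) = C (n * a) * (C a * X + C b) ^ n := by
  cases n with
  | zero => simp
  | succ n =>
    rw [derivative_pow]
    simp only [derivative_add, derivative_C, derivative_mul, derivative_X, map_mul, map_natCast]
    simp only [Nat.add_sub_cancel]
    ring

open Polynomial in
lemma rotPoly_derivative (r s : ℝ) (k l : ℕ) :
    (C r * X + C s) * (C (-s) * X + C r) * derivative (rotPoly r s k l) =
      (C (k * r) * (C (-s) * X + C r) - C (l * s) * (C r * X + C s)) * rotPoly r s k l := by
  unfold rotPoly
  rw [derivative_mul]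
  have h1 := linear_mul_derivative_pow r s k
  have h2 := linear_mul_derivative_pow (-s) r l
  simp only [map_mul, map_neg] at *
  linear_combination (-C s * X + C r) * (-C s * X + C r) ^ l * h1
    + (C r * X + C s) ^ k * (C r * X + C s) * h2

open Polynomial in
lemma rotPoly_directional_left (r s : ℝ) (h : r ^ 2 + s ^ 2 = 1) (k l : ℕ) :
    C r * derivative (rotPoly r s (k + 1) l) + C s * (C (((k + l : ℕ) : ℝ) + 1) *
      rotPoly r s (k + 1) l - X * derivative (rotPoly r s (k + 1) l)) =
      C ((k : ℝ) + 1) * rotPoly r s k l := by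
  have h' : C r ^ 2 + C s ^ 2 = (1 : ℝ[X]) := by rw [← map_pow, ← map_pow, ← map_add, h, map_one]
  have h2 := linear_mul_derivative_pow (-s) r l
  unfold rotPoly
  rw [derivative_mul, derivative_pow]
  simp only [map_mul, map_neg, map_add, map_natCast, map_one, Nat.cast_add, derivative_C,
    derivative_mul, derivative_X, Nat.add_sub_cancel, Nat.cast_one] at *
  linear_combination (C r * X + C s) ^ (k + 1) * h2 +
    ((k : ℝ[X]) + 1) * (C r * X + C s) ^ k * (-C s * X + C r) ^ l * h'

open Polynomial in
lemma rotPoly_directional_right (r s : ℝ) (h : r ^ 2 + s ^ 2 = 1) (k l : ℕ) :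
    C (-s) * derivative (rotPoly r s k (l + 1)) + C r * (C (((k + l : ℕ) : ℝ) + 1) *
      rotPoly r s k (l + 1) - X * derivative (rotPoly r s k (l + 1))) =
      C ((l : ℝ) + 1) * rotPoly r s k l := by
  have h' : C r ^ 2 + C s ^ 2 = (1 : ℝ[X]) := by rw [← map_pow, ← map_pow, ← map_add, h, map_one]
  have h2 := linear_mul_derivative_pow r s k
  unfold rotPoly
  rw [derivative_mul, derivative_pow (C (-s) * X + C r)]
  simp only [map_mul, map_neg, map_add, map_natCast, map_one, Nat.cast_add, derivative_C,
    derivative_mul, derivative_X, Nat.add_sub_cancel, Nat.cast_one] at *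
  linear_combination -(-C s * X + C r) ^ (l + 1) * h2 +
    ((l : ℝ[X]) + 1) * (C r * X + C s) ^ k * (-C s * X + C r) ^ l * h'

open Polynomial in
lemma bombieri_C_mul (N : ℕ) (a : ℝ) (P Q : ℝ[X]) :
    bombieri N P (C a * Q) = a * bombieri N P Q := by
  unfold bombieri
  rw [Finset.mul_sum]
  refine Finset.sum_congr rfl fun j _ => ?_
  rw [coeff_C_mul]; ring

open Polynomial in
lemma bombieri_rotPoly (r s : ℝ) (h : r ^ 2 + s ^ 2 = 1) (k l : ℕ) :
    bombieri (k + l) (rotPoly r s k l) (rotPoly r s k l) = k.factorial * l.factorial := by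
  induction l with
  | zero =>
    induction k with
    | zero => simp [bombieri, rotPoly]
    | succ k ih =>
      have e : rotPoly r s (k + 1) 0 = (C r * X + C s) * rotPoly r s k 0 := by
        unfold rotPoly; ring
      have := bombieri_linear_mul (k + 0) r s (rotPoly r s k 0) (rotPoly r s (k + 1) 0)
        (natDegree_rotPoly_le r s k 0)
      rw [rotPoly_directional_left r s h, bombieri_C_mul, ih, ← e] at this
      rw [show k + 1 + 0 = k + 0 + 1 by ring, this, Nat.factorial_succ]
      push_cast; ring
  | succ l ih =>
    have e : rotPoly r s k (l + 1) = (C (-s) * X + C r) * rotPoly r s k l := by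
      unfold rotPoly; ring
    have := bombieri_linear_mul (k + l) (-s) r (rotPoly r s k l) (rotPoly r s k (l + 1))
      (natDegree_rotPoly_le r s k l)
    rw [rotPoly_directional_right r s h, bombieri_C_mul, ih, ← e] at this
    rw [← add_assoc, this, Nat.factorial_succ l]
    push_cast; ring

open Polynomial in
lemma coeff_linear_pow (a b : ℝ) (n i : ℕ) :
    ((C a * X + C b) ^ n).coeff i = n.choose i * a ^ i * b ^ (n - i) := by
  rw [add_pow, finsetSum_coeff]
  have : ∀ j ∈ Finset.range (n + 1), ((C a * X) ^ j * C b ^ (n - j) * (n.choose j : ℝ[X])).coeff i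
      = if i = j then n.choose i * a ^ i * b ^ (n - i) else 0 := by
    intro j _
    have : (C a * X) ^ j * C b ^ (n - j) * (n.choose j : ℝ[X]) =
        C (n.choose j * a ^ j * b ^ (n - j)) * X ^ j := by
      simp only [map_mul, map_pow, map_natCast]; ring
    rw [this, coeff_C_mul, coeff_X_pow]
    split_ifs with hij
    · subst hij; ring
    · ring
  rw [Finset.sum_congr rfl this, Finset.sum_ite_eq]
  split_ifs with hi
  · rfl
  · rw [Nat.choose_eq_zero_of_lt (by simpa [Nat.lt_succ_iff] using hi)]; simp

lemma rotPoly_coeff_eq_jacobiR (r s : ℝ) (h : r ^ 2 + s ^ 2 = 1) (d n : ℕ) :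
    (rotPoly r s (n + d) n).coeff (n + d) = r ^ d * jacobiR 0 d n (2 * r ^ 2 - 1) := by
  unfold rotPoly jacobiR
  rw [mul_comm, Polynomial.coeff_mul, Finset.Nat.sum_antidiagonal_eq_sum_range_succ_mk]
  simp only [coeff_linear_pow]
  have hsub : Finset.range (n + 1) ⊆ Finset.range (n + d).succ := by
    intro x; simp; omega
  rw [← Finset.sum_subset hsub]
  · simp only [add_zero, Nat.choose_self, Nat.cast_one, div_one, Finset.mul_sum]
    refine Finset.sum_congr rfl fun i hi => ?_
    have hi : i ≤ n := by simpa [Nat.lt_succ_iff] using hi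
    rw [show (2 * r ^ 2 - 1 - 1) / 2 = -s * s by linarith,
      show (2 * r ^ 2 - 1 + 1) / 2 = r ^ 2 by ring, Nat.choose_symm hi,
      Nat.choose_symm (by omega : i ≤ n + d), show n + d - (n + d - i) = i by omega,
      show n + d - i = d + (n - i) by omega, mul_pow, ← pow_mul, pow_add, two_mul, pow_add]
    ring
  · intro i _ hi
    rw [Nat.choose_eq_zero_of_lt (by simpa [Nat.lt_succ_iff] using hi)]; simp

/-- Coefficients of `rotPoly`, normalized in the Bombieri norm. -/
def rotCoeff (r s : ℝ) (k l j : ℕ) : ℝ :=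
  (rotPoly r s k l).coeff j * √((j.factorial * (k + l - j).factorial : ℝ) / (k.factorial * l.factorial))

lemma rotCoeff_self (r s : ℝ) (k l : ℕ) : rotCoeff r s k l k = (rotPoly r s k l).coeff k := by
  unfold rotCoeff
  rw [Nat.add_sub_cancel_left, div_self (by positivity)]; simp

lemma rotCoeff_eq_zero (r s : ℝ) {k l j : ℕ} (hj : k + l < j) : rotCoeff r s k l j = 0 := by
  unfold rotCoeff
  rw [Polynomial.coeff_eq_zero_of_natDegree_lt ((natDegree_rotPoly_le r s k l).trans_lt hj), zero_mul]

lemma sum_rotCoeff_sq (r s : ℝ) (h : r ^ 2 + s ^ 2 = 1) (k l : ℕ) :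
    ∑ j ∈ Finset.range (k + l + 1), rotCoeff r s k l j ^ 2 = 1 := by
  have := bombieri_rotPoly r s h k l
  unfold bombieri at this
  have hpos : (0 : ℝ) < k.factorial * l.factorial := by positivity
  have h1 := congrArg (· / ((k.factorial : ℝ) * l.factorial)) this
  simp only [div_self hpos.ne'] at h1
  rw [← h1, Finset.sum_div]
  refine Finset.sum_congr rfl fun j _ => ?_
  unfold rotCoeff
  rw [mul_pow, Real.sq_sqrt (by positivity)]
  ring

lemma sum_rotCoeff_sq_le (r s : ℝ) (h : r ^ 2 + s ^ 2 = 1) (k l : ℕ) (F : Finset ℕ) :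
    ∑ j ∈ F, rotCoeff r s k l j ^ 2 ≤ 1 := by
  rw [← sum_rotCoeff_sq r s h k l]
  rw [← Finset.sum_filter_of_ne (s := F) (p := fun j => j ∈ Finset.range (k + l + 1))]
  · refine Finset.sum_le_sum_of_subset_of_nonneg (fun j hj => (Finset.mem_filter.1 hj).2) ?_
    intros; positivity
  · intro j _ hj
    by_contra hc
    refine hj ?_
    rw [rotCoeff_eq_zero r s (by simpa [Nat.lt_succ_iff] using hc)]; simp

lemma abs_rotCoeff_le (r s : ℝ) (h : r ^ 2 + s ^ 2 = 1) (k l j : ℕ) :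
    |rotCoeff r s k l j| ≤ 1 := by
  have := sum_rotCoeff_sq_le r s h k l {j}
  rw [Finset.sum_singleton] at this
  exact (sq_le_one_iff_abs_le_one _).1 this

open Polynomial in
lemma rotPoly_coeff_rec (r s : ℝ) (k l j : ℕ) :
    r * s * ((j + 2) * (rotPoly r s k l).coeff (j + 2) +
      ((k : ℝ) + l - j) * (rotPoly r s k l).coeff j) =
    (k * r ^ 2 - l * s ^ 2 - (r ^ 2 - s ^ 2) * (j + 1)) * (rotPoly r s k l).coeff (j + 1) := by
  have h := congrArg (fun P => P.coeff (j + 1)) (rotPoly_derivative r s k l)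
  set P := rotPoly r s k l
  have e1 : (C r * X + C s) * (C (-s) * X + C r) * derivative P =
      C (r * s) * derivative P + C (r ^ 2 - s ^ 2) * (X * derivative P)
        + C (-(r * s)) * (X * (X * derivative P)) := by
    simp only [map_mul, map_neg, map_sub, map_pow]; ring
  have e2 : (C (k * r) * (C (-s) * X + C r) - C (l * s) * (C r * X + C s)) * P =
      C (k * r ^ 2 - l * s ^ 2) * P + C (-(r * s * (k + l))) * (X * P) := by
    simp only [map_mul, map_neg, map_sub, map_pow, map_add]; ring
  have hx : (X * derivative P).coeff j = j * P.coeff j := by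
    cases j with
    | zero => simp
    | succ j => rw [coeff_X_mul, coeff_derivative]; push_cast; ring
  simp only [e1, e2, coeff_add, coeff_C_mul, coeff_X_mul, hx] at h
  rw [coeff_derivative, coeff_derivative] at h
  push_cast at h
  linear_combination h

lemma rotCoeff_rec (r s : ℝ) (k l j : ℕ) :
    r * s * (√((j + 2) * ((k : ℝ) + l - (j + 1))) * rotCoeff r s k l (j + 2) +
      √((j + 1) * ((k : ℝ) + l - j)) * rotCoeff r s k l j) =
    (k * r ^ 2 - l * s ^ 2 - (r ^ 2 - s ^ 2) * (j + 1)) * rotCoeff r s k l (j + 1) := by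
  rcases lt_or_ge (k + l) (j + 1) with hj | hj
  · rw [rotCoeff_eq_zero r s hj, rotCoeff_eq_zero r s (hj.trans (Nat.lt_succ_self _))]
    have : ((k : ℝ) + l - j) ≤ 0 := by
      have : k + l ≤ j := by omega
      have : (k : ℝ) + l ≤ j := by exact_mod_cast this
      linarith
    rw [Real.sqrt_eq_zero_of_nonpos (mul_nonpos_of_nonneg_of_nonpos (by positivity) this)]
    ring
  obtain ⟨e, he⟩ := Nat.exists_eq_add_of_le hj
  have hR : (k : ℝ) + l = j + 1 + e := by exact_mod_cast he
  have hrec := rotPoly_coeff_rec r s k l j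
  have h0 : √((j + 1) * ((k : ℝ) + l - j)) * rotCoeff r s k l j =
      ((k : ℝ) + l - j) * (rotPoly r s k l).coeff j *
      √(((j + 1).factorial * e.factorial : ℝ) / (k.factorial * l.factorial)) := by
    unfold rotCoeff
    rw [he, show j + 1 + e - j = e + 1 by omega, hR, Nat.factorial_succ j, Nat.factorial_succ e]
    push_cast
    rw [show (j : ℝ) + 1 + e - j = e + 1 by ring,
      mul_left_comm, ← Real.sqrt_mul (by positivity),
      show ((j : ℝ) + 1) * (e + 1) * (j.factorial * ((e + 1) * e.factorial) /
        (k.factorial * l.factorial)) = (e + 1) ^ 2 * ((j + 1) * j.factorial * e.factorial /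
        (k.factorial * l.factorial)) by ring, Real.sqrt_mul (by positivity),
      Real.sqrt_sq (by positivity)]
    ring
  have h1 : rotCoeff r s k l (j + 1) = (rotPoly r s k l).coeff (j + 1) *
      √(((j + 1).factorial * e.factorial : ℝ) / (k.factorial * l.factorial)) := by
    unfold rotCoeff
    rw [he, show j + 1 + e - (j + 1) = e by omega]
  have h2 : √((j + 2) * ((k : ℝ) + l - (j + 1))) * rotCoeff r s k l (j + 2) =
      (j + 2) * (rotPoly r s k l).coeff (j + 2) *
      √(((j + 1).factorial * e.factorial : ℝ) / (k.factorial * l.factorial)) := by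
    rcases e with _ | e
    · rw [rotCoeff_eq_zero r s (by omega), Polynomial.coeff_eq_zero_of_natDegree_lt
        ((natDegree_rotPoly_le r s k l).trans_lt (by omega))]
      ring
    · unfold rotCoeff
      rw [he, show j + 1 + (e + 1) - (j + 2) = e by omega, hR, Nat.factorial_succ (j + 1),
        Nat.factorial_succ e]
      push_cast
      rw [show (j : ℝ) + 1 + (e + 1) - (j + 1) = e + 1 by ring,
        mul_left_comm, ← Real.sqrt_mul (by positivity),
        show ((j : ℝ) + 2) * (e + 1) * ((j + 1 + 1) * (j + 1).factorial * e.factorial /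
          (k.factorial * l.factorial)) = (j + 2) ^ 2 * ((j + 1).factorial *
          ((e + 1) * e.factorial) / (k.factorial * l.factorial)) by ring,
        Real.sqrt_mul (by positivity), Real.sqrt_sq (by positivity)]
      ring
  rw [h0, h1, h2]
  linear_combination √(((j + 1).factorial * e.factorial : ℝ) / (k.factorial * l.factorial)) * hrec

/-! ### Decay of Jacobi and disc polynomials -/

open Filter Topology Polynomial.Chebyshev in
/-- A square-summable two-sided solution of `Y (i+1) + Y (i-1) = κ Y i` vanishes at `0`. -/
lemma eq_zero_of_bounded_rec (Y : ℤ → ℝ) (κ : ℝ) (hrec : ∀ i, Y (i + 1) + Y (i - 1) = κ * Y i)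
    (hs : ∀ F : Finset ℤ, ∑ i ∈ F, Y i ^ 2 ≤ 1) : Y 0 = 0 := by
  by_contra h0
  have hsum : Summable fun i => Y i ^ 2 :=
    summable_of_sum_le (fun i => sq_nonneg _) hs
  have hY : Tendsto Y cofinite (𝓝 0) := by
    have := hsum.tendsto_cofinite_zero.sqrt
    simp only [Real.sqrt_sq_eq_abs, Real.sqrt_zero] at this
    exact (tendsto_zero_iff_abs_tendsto_zero _).2 this
  set t : ℕ → ℝ := fun n => (T ℝ (n : ℤ)).eval (κ / 2) with ht
  have hcheb : ∀ n : ℕ, Y n + Y (-n) = 2 * t n * Y 0 ∧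
      Y (n + 1) + Y (-(n + 1)) = 2 * t (n + 1) * Y 0 := by
    intro n
    induction n with
    | zero =>
      have := hrec 0
      simp only [zero_add, zero_sub] at this
      simp only [ht]
      simp
      constructor
      · ring
      · rw [this]; ring
    | succ n ih =>
      refine ⟨by exact_mod_cast ih.2, ?_⟩
      have h1 := hrec (n + 1)
      have h2 := hrec (-(n + 1))
      rw [show (n : ℤ) + 1 - 1 = n by ring] at h1
      rw [show -((n : ℤ) + 1) + 1 = -n by ring, show -((n : ℤ) + 1) - 1 = -(n + 1 + 1) by ring] at h2
      have h3 : t (n + 1 + 1) = κ * t (n + 1) - t n := by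
        simp only [ht]
        push_cast
        rw [show (n : ℤ) + 1 + 1 = n + 2 by ring, T_add_two]
        simp only [Polynomial.eval_sub, Polynomial.eval_mul, Polynomial.eval_ofNat, Polynomial.eval_X]
        ring
      push_cast
      rw [h3]
      linear_combination h1 + h2 + κ * ih.2 - ih.1
  have hdouble : ∀ n, t (2 * n) = 2 * t n ^ 2 - 1 := by
    intro n
    have := congrArg (fun P => P.eval (κ / 2)) (T_mul_T ℝ (n : ℤ) n)
    simp only [Polynomial.eval_mul, Polynomial.eval_add, sub_self, T_zero, Polynomial.eval_one] at this
    simp only [ht]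
    push_cast
    rw [two_mul (n : ℤ)]
    simp at this
    linear_combination -this
  have hcast : Tendsto (fun n : ℕ => (n : ℤ)) atTop cofinite := by
    rw [← Nat.cofinite_eq_atTop]; exact Nat.cast_injective.tendsto_cofinite
  have hneg : Tendsto (fun n : ℕ => (-n : ℤ)) atTop cofinite := by
    rw [← Nat.cofinite_eq_atTop]
    exact (neg_injective.comp Nat.cast_injective).tendsto_cofinite
  have ht0 : Tendsto t atTop (𝓝 0) := by
    have := ((hY.comp hcast).add (hY.comp hneg)).div_const (2 * Y 0)
    simp only [add_zero, zero_div] at this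
    refine this.congr fun n => ?_
    simp only [Function.comp]
    rw [(hcheb n).1]; field_simp
  have h2 : Tendsto (fun n => t (2 * n)) atTop (𝓝 0) :=
    ht0.comp (tendsto_id.const_mul_atTop' two_pos)
  have h3 : Tendsto (fun n => t (2 * n)) atTop (𝓝 (2 * 0 ^ 2 - 1)) := by
    simp only [hdouble]
    exact ((ht0.pow 2).const_mul 2).sub_const 1
  have := tendsto_nhds_unique h2 h3
  norm_num at this

open Filter Topology in
lemma exists_tendsto_of_mem_Icc {α : Type*} (g : Ultrafilter α) (φ : α → ℝ) (a b : ℝ)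
    (h : ∀ v, φ v ∈ Set.Icc a b) : ∃ x ∈ Set.Icc a b, Tendsto φ g (𝓝 x) := by
  obtain ⟨x, hx, hle⟩ := (isCompact_Icc (a := a) (b := b)).ultrafilter_le_nhds (g.map φ)
    (by
      rw [Filter.le_principal_iff]
      exact Filter.mem_map.2 (Filter.univ_mem' h))
  exact ⟨x, hx, hle⟩

open Filter Topology in
lemma tendsto_rotCoeff_self (r s : ℝ) (hr : 0 < r) (hs : 0 < s) (h : r ^ 2 + s ^ 2 = 1) :
    Tendsto (fun v : ℕ × ℕ => rotCoeff r s (v.2 + v.1) v.2 (v.2 + v.1))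
      (comap Prod.fst atTop) (𝓝 0) := by
  rw [tendsto_iff_ultrafilter]
  intro g hg
  set k : ℕ × ℕ → ℝ := fun v => (v.2 : ℝ) + v.1 with hk
  set φ : ℤ → ℕ × ℕ → ℝ := fun i v =>
    rotCoeff r s (v.2 + v.1) v.2 ((((v.2 + v.1 : ℕ) : ℤ) + i).toNat) with hφ
  have hd : Tendsto (fun v : ℕ × ℕ => v.1) g atTop := tendsto_comap.mono_left hg
  have hkN : Tendsto (fun v : ℕ × ℕ => v.2 + v.1) g atTop :=
    tendsto_atTop_mono (fun v => Nat.le_add_left _ _) hd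
  have hkT : Tendsto k g atTop := by
    have := tendsto_natCast_atTop_atTop (R := ℝ) |>.comp hkN
    refine this.congr fun v => ?_
    simp [hk]
  have hkpos : ∀ᶠ v in g, 0 < k v := hkT.eventually_gt_atTop 0
  have hlim : ∀ i, ∃ x ∈ Set.Icc (-1 : ℝ) 1, Tendsto (φ i) g (𝓝 x) := fun i =>
    exists_tendsto_of_mem_Icc g _ _ _ fun v => abs_le.1 (abs_rotCoeff_le r s h _ _ _)
  choose Y _ hY using hlim
  obtain ⟨τ, ⟨hτ0, hτ1⟩, hτ⟩ := exists_tendsto_of_mem_Icc g (fun v => (v.2 : ℝ) / k v) 0 1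
    (fun v => ⟨by positivity, div_le_one_of_le₀ (by simp [hk]) (by positivity)⟩)
  have hconst : ∀ x : ℝ, Tendsto (fun v => x / k v) g (𝓝 0) := fun x =>
    hkT.const_div_atTop x
  have hsq : ∀ x y : ℝ, Tendsto (fun v => √((k v + x) * (v.2 + y)) / k v) g (𝓝 (√τ)) := by
    intro x y
    have h1 : Tendsto (fun v => √((1 + x / k v) * ((v.2 : ℝ) / k v + y / k v))) g
        (𝓝 (√((1 + 0) * (τ + 0)))) :=
      ((tendsto_const_nhds.add (hconst x)).mul (hτ.add (hconst y))).sqrt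
    simp only [add_zero, one_mul] at h1
    refine h1.congr' ?_
    filter_upwards [hkpos] with v hv
    have : (1 + x / k v) * ((v.2 : ℝ) / k v + y / k v) = ((k v + x) * (v.2 + y)) / (k v) ^ 2 := by
      field_simp
    rw [this, Real.sqrt_div' _ (by positivity), Real.sqrt_sq hv.le]
  have hrec : ∀ i, r * s * (√τ * Y (i + 1) + √τ * Y (i - 1)) = s ^ 2 * (1 - τ) * Y i := by
    intro i
    have hL := (((hsq (i + 1) (-i)).mul (hY (i + 1))).add
      ((hsq i (-i + 1)).mul (hY (i - 1)))).const_mul (r * s)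
    have hR : Tendsto (fun v => (r ^ 2 - (v.2 : ℝ) / k v * s ^ 2 -
        (r ^ 2 - s ^ 2) * (1 + i / k v)) * φ i v) g
        (𝓝 ((r ^ 2 - τ * s ^ 2 - (r ^ 2 - s ^ 2) * (1 + 0)) * Y i)) :=
      (((tendsto_const_nhds.sub (hτ.mul_const _)).sub
        ((tendsto_const_nhds.add (hconst i)).const_mul _))).mul (hY i)
    rw [show s ^ 2 * (1 - τ) * Y i = (r ^ 2 - τ * s ^ 2 - (r ^ 2 - s ^ 2) * (1 + 0)) * Y i by ring]
    refine tendsto_nhds_unique (hL.congr' ?_) hR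
    filter_upwards [hkpos, hkN.eventually_ge_atTop (i.natAbs + 1)] with v hv hvi
    obtain ⟨j, hj⟩ : ∃ j : ℕ, ((v.2 + v.1 : ℕ) : ℤ) + i = j + 1 :=
      ⟨(((v.2 + v.1 : ℕ) : ℤ) + i - 1).toNat, by omega⟩
    have hjR : (j : ℝ) = k v + i - 1 := by
      have : (((v.2 + v.1 : ℕ) : ℤ) + i : ℝ) = j + 1 := by exact_mod_cast hj
      simp only [hk]
      push_cast at this
      linarith
    have := rotCoeff_rec r s (v.2 + v.1) v.2 j
    simp only [hφ]
    rw [show (((v.2 + v.1 : ℕ) : ℤ) + (i + 1)).toNat = j + 2 by omega,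
      show (((v.2 + v.1 : ℕ) : ℤ) + i).toNat = j + 1 by omega,
      show (((v.2 + v.1 : ℕ) : ℤ) + (i - 1)).toNat = j by omega]
    rw [show ((v.2 + v.1 : ℕ) : ℝ) = k v by simp [hk], hjR] at this
    rw [show (k v + i - 1 + 2) * (k v + v.2 - (k v + i - 1 + 1)) = (k v + (i + 1)) * (v.2 + -i) by ring,
      show (k v + i - 1 + 1) * (k v + v.2 - (k v + i - 1)) = (k v + i) * (v.2 + (-i + 1)) by ring] at this
    field_simp
    linear_combination this
  have hφ0 : ∀ v : ℕ × ℕ, rotCoeff r s (v.2 + v.1) v.2 (v.2 + v.1) = φ 0 v := by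
    intro v; simp only [hφ, add_zero, Int.toNat_natCast]
  simp only [hφ0]
  suffices hz : Y 0 = 0 by rw [← hz]; exact hY 0
  rcases hτ0.eq_or_lt with hτz | hτpos
  · have := hrec 0
    rw [← hτz] at this
    simp [hs.ne'] at this
    exact this
  · have hst : 0 < √τ := Real.sqrt_pos.2 hτpos
    refine eq_zero_of_bounded_rec Y (s * (1 - τ) / (r * √τ)) (fun i => ?_) (fun F => ?_)
    · have := hrec i
      field_simp
      have h2 : s * (r * √τ * (Y (i + 1) + Y (i - 1)) - s * (1 - τ) * Y i) = 0 := by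
        linear_combination this
      rcases mul_eq_zero.1 h2 with h3 | h3
      · exact absurd h3 hs.ne'
      · linear_combination h3
    · refine le_of_tendsto (tendsto_finsetSum F fun i _ => (hY i).pow 2) ?_
      have hev : ∀ᶠ v in (g : Filter (ℕ × ℕ)), ∀ i ∈ F, i.natAbs ≤ v.2 + v.1 :=
        (Filter.eventually_all_finset F).2 fun i _ => hkN.eventually_ge_atTop _
      filter_upwards [hev] with v hv
      have hinj : Set.InjOn (fun i : ℤ => (((v.2 + v.1 : ℕ) : ℤ) + i).toNat) F := by
        intro i hi j hj hij
        have := hv i hi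
        have := hv j hj
        simp only at hij
        omega
      have := sum_rotCoeff_sq_le r s h (v.2 + v.1) v.2
        (F.image fun i : ℤ => (((v.2 + v.1 : ℕ) : ℤ) + i).toNat)
      rwa [Finset.sum_image hinj] at this

lemma abs_pow_mul_jacobiR_zero_le_one (r : ℝ) (hr0 : 0 ≤ r) (hr1 : r ≤ 1) (d n : ℕ) :
    |r ^ d * jacobiR 0 d n (2 * r ^ 2 - 1)| ≤ 1 := by
  have h : r ^ 2 + √(1 - r ^ 2) ^ 2 = 1 := by
    rw [Real.sq_sqrt (by nlinarith)]; ring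
  rw [← rotPoly_coeff_eq_jacobiR r _ h, ← rotCoeff_self]
  exact abs_rotCoeff_le _ _ h _ _ _

open Filter Topology in
lemma abs_pow_mul_jacobiR_zero_small (r : ℝ) (hr0 : 0 ≤ r) (hr1 : r < 1) {ε : ℝ} (hε : 0 < ε) :
    ∃ D : ℕ, ∀ d ≥ D, ∀ n, |r ^ d * jacobiR 0 d n (2 * r ^ 2 - 1)| ≤ ε := by
  rcases hr0.eq_or_lt with rfl | hr
  · refine ⟨1, fun d hd n => ?_⟩
    rw [zero_pow (by omega)]; simp [hε.le]
  have hpos : 0 < 1 - r ^ 2 := by nlinarith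
  have h : r ^ 2 + √(1 - r ^ 2) ^ 2 = 1 := by
    rw [Real.sq_sqrt hpos.le]; ring
  have := (tendsto_rotCoeff_self r _ hr (Real.sqrt_pos.2 hpos) h).eventually
    (Metric.closedBall_mem_nhds _ hε)
  rw [eventually_comap] at this
  obtain ⟨D, hD⟩ := eventually_atTop.1 this
  refine ⟨D, fun d hd n => ?_⟩
  have := hD d hd (d, n) rfl
  rw [← rotPoly_coeff_eq_jacobiR r _ h, ← rotCoeff_self]
  simpa using this

/-- Positive connection formula raising the first parameter of a Jacobi polynomial. -/
lemma jacobiR_succ (α β n : ℕ) (x : ℝ) :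
    ((n : ℝ) + 1 + α + β + 1) * ((n + 1 + (α + 1)).choose (n + 1) : ℝ) * jacobiR (α + 1) β (n + 1) x =
      (2 * ((n : ℝ) + 1) + α + β + 1) * ((n + 1 + α).choose (n + 1) : ℝ) * jacobiR α β (n + 1) x +
      ((n : ℝ) + 1 + β) * ((n + (α + 1)).choose n : ℝ) * jacobiR (α + 1) β n x := by
  have hc : ∀ a b : ℕ, ((a + b).choose a : ℝ) ≠ 0 := fun a b => by
    exact_mod_cast (Nat.choose_pos (Nat.le_add_right a b)).ne'
  unfold jacobiR
  simp only [mul_assoc, mul_div_cancel₀ _ (hc _ _)]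
  set u := (x - 1) / 2 with hu
  set v := (x + 1) / 2 with hv
  have huv : v - u = 1 := by rw [hu, hv]; ring
  set E : ℕ → ℝ := fun s => ((n + 1 + α).choose (n + 1 - s) : ℝ) with hE
  set F : ℕ → ℝ := fun s => ((n + 1 + (α + 1)).choose (n + 1 - s) : ℝ) - E s with hF
  set B : ℕ → ℝ := fun s => ((n + 1 + β).choose s : ℝ) with hB
  have hFlt : ∀ s ≤ n, F s = ((n + (α + 1)).choose (n - s) : ℝ) := by
    intro s hs
    simp only [hF, hE]
    rw [show n + 1 - s = (n - s) + 1 by omega, show n + 1 + (α + 1) = (n + 1 + α) + 1 by ring,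
      Nat.choose_succ_succ', show n + (α + 1) = n + 1 + α by ring]
    push_cast; ring
  have hFlast : F (n + 1) = 0 := by simp [hF, hE]
  have hEF : ∀ s ∈ Finset.range (n + 2), ((n : ℝ) + 1 - s) * E s = (α + 1 + s) * F s := by
    intro s hs
    rcases Nat.lt_succ_iff_lt_or_eq.1 (Finset.mem_range.1 hs) with hs | rfl
    · obtain ⟨e, rfl⟩ := Nat.exists_eq_add_of_le (Nat.lt_succ_iff.1 hs)
      rw [hFlt s (by omega)]
      simp only [hE]
      have := Nat.choose_succ_right_eq (s + e + 1 + α) e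
      rw [show s + e + 1 + α - e = s + 1 + α by omega] at this
      have h' : ((s + e + 1 + α).choose (e + 1) : ℝ) * (e + 1) =
        (s + e + 1 + α).choose e * (s + 1 + α) := by exact_mod_cast this
      rw [show s + e + 1 - s = e + 1 by omega, show s + e - s = e by omega,
        show s + e + (α + 1) = s + e + 1 + α by ring]
      push_cast
      linear_combination h'
    · rw [hFlast]; push_cast; ring
  have hv1 : v * (((n : ℝ) + 1 + β) * ∑ s ∈ Finset.range (n + 1), ((n + (α + 1)).choose (n - s) : ℝ) *
      (((n + β).choose s : ℝ) * (u ^ s * v ^ (n - s)))) =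
      ∑ s ∈ Finset.range (n + 2), ((n : ℝ) + 1 + β - s) * F s * (B s * (u ^ s * v ^ (n + 1 - s))) := by
    rw [Finset.sum_range_succ _ (n + 1), hFlast]
    simp only [mul_zero, zero_mul, add_zero, Finset.mul_sum]
    refine Finset.sum_congr rfl fun s hs => ?_
    have hs : s ≤ n := by simpa [Nat.lt_succ_iff] using hs
    have := Nat.choose_mul_succ_eq (n + β) s
    have h' : ((n + β).choose s : ℝ) * (n + β + 1) = (n + 1 + β).choose s * (n + 1 + β - s) := by
      rw [show n + 1 + β = n + β + 1 by ring]
      rw [show (n : ℝ) + 1 + β - s = ((n + β + 1 - s : ℕ) : ℝ) by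
        rw [Nat.cast_sub (by omega)]; push_cast; ring]
      exact_mod_cast this
    rw [hFlt s hs, show n + 1 - s = (n - s) + 1 by omega, pow_succ]
    simp only [hB]
    linear_combination v * ((n + (α + 1)).choose (n - s) : ℝ) * (u ^ s * v ^ (n - s)) * h'
  have hu1 : u * (((n : ℝ) + 1 + β) * ∑ s ∈ Finset.range (n + 1), ((n + (α + 1)).choose (n - s) : ℝ) *
      (((n + β).choose s : ℝ) * (u ^ s * v ^ (n - s)))) =
      ∑ s ∈ Finset.range (n + 2), (s : ℝ) * E s * (B s * (u ^ s * v ^ (n + 1 - s))) := by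
    rw [Finset.sum_range_succ' _ (n + 1)]
    simp only [Nat.cast_zero, zero_mul, add_zero, Finset.mul_sum]
    refine Finset.sum_congr rfl fun s hs => ?_
    have := Nat.add_one_mul_choose_eq (n + β) s
    have h' : ((n : ℝ) + β + 1) * (n + β).choose s = (n + 1 + β).choose (s + 1) * (s + 1) := by
      rw [show n + 1 + β = n + β + 1 by ring]
      exact_mod_cast this
    simp only [hB, hE]
    rw [show n + 1 - (s + 1) = n - s by omega, show n + 1 + α = n + (α + 1) by ring, pow_succ]
    push_cast
    linear_combination u * ((n + (α + 1)).choose (n - s) : ℝ) * (u ^ s * v ^ (n - s)) * h'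
  have hT : ∀ T : ℝ, T = v * T - u * T := fun T => by rw [← sub_mul, huv, one_mul]
  rw [hT (((n : ℝ) + 1 + β) * ∑ s ∈ Finset.range (n + 1), _), hv1, hu1, Finset.mul_sum,
    Finset.mul_sum, ← Finset.sum_sub_distrib, ← Finset.sum_add_distrib]
  refine Finset.sum_congr rfl fun s hs => ?_
  have h1 := hEF s hs
  have h2 : ((n + 1 + (α + 1)).choose (n + 1 - s) : ℝ) = E s + F s := by simp only [hF]; ring
  rw [h2]
  linear_combination -(B s * (u ^ s * v ^ (n + 1 - s))) * h1

lemma jacobiR_zero_right (α β : ℕ) (x : ℝ) : jacobiR α β 0 x = 1 := by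
  simp [jacobiR]

lemma jacobiR_one (α β n : ℕ) : jacobiR α β n 1 = 1 := by
  have : ((n + α).choose n : ℝ) ≠ 0 := by
    exact_mod_cast (Nat.choose_pos (Nat.le_add_right n α)).ne'
  unfold jacobiR
  rw [Finset.sum_range_succ']
  simp [this]

lemma abs_mul_jacobiR_le (β : ℕ) (x ρ ε : ℝ) (h : ∀ n, |ρ * jacobiR 0 β n x| ≤ ε) (α n : ℕ) :
    |ρ * jacobiR α β n x| ≤ ε := by
  induction α generalizing n with
  | zero => exact h n
  | succ α ihα =>
    induction n with
    | zero => simpa [jacobiR_zero_right] using h 0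
    | succ n ih =>
      have hrec := jacobiR_succ α β n x
      have hone := jacobiR_succ α β n 1
      simp only [jacobiR_one, mul_one] at hone
      have hA : (0 : ℝ) < ((n + 1 + (α + 1)).choose (n + 1) : ℝ) := by
        exact_mod_cast Nat.choose_pos (Nat.le_add_right _ _)
      set A := ((n : ℝ) + 1 + α + β + 1) * ((n + 1 + (α + 1)).choose (n + 1) : ℝ)
      set b := (2 * ((n : ℝ) + 1) + α + β + 1) * ((n + 1 + α).choose (n + 1) : ℝ)
      set c := ((n : ℝ) + 1 + β) * ((n + (α + 1)).choose n : ℝ)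
      have hA0 : 0 < A := by positivity
      have hb0 : 0 ≤ b := by positivity
      have hc0 : 0 ≤ c := by positivity
      refine le_of_mul_le_mul_left ?_ hA0
      calc A * |ρ * jacobiR (α + 1) β (n + 1) x|
          = |A * (ρ * jacobiR (α + 1) β (n + 1) x)| := by rw [abs_mul A, abs_of_pos hA0]
        _ = |b * (ρ * jacobiR α β (n + 1) x) + c * (ρ * jacobiR (α + 1) β n x)| := by
            congr 1; linear_combination ρ * hrec
        _ ≤ b * |ρ * jacobiR α β (n + 1) x| + c * |ρ * jacobiR (α + 1) β n x| := by
            refine (abs_add_le _ _).trans ?_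
            rw [abs_mul b, abs_mul c, abs_of_nonneg hb0, abs_of_nonneg hc0]
        _ ≤ b * ε + c * ε := by gcongr; exact ihα _
        _ = A * ε := by rw [hone]; ring

lemma norm_discR_top (k l : ℕ) (η : ℂ) : ‖discR ⊤ k l η‖ = ‖η‖ ^ (k + l) := by
  simp [discR, pow_add]

lemma norm_discR_of_ne_top {p : ℕ∞} (hp : 2 ≤ p) (hp' : p ≠ ⊤) (k l : ℕ) (η : ℂ) :
    ‖discR p k l η‖ = |‖η‖ ^ (max k l - min k l) * jacobiR (p.toNat - 2) (max k l - min k l)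
      (min k l) (2 * ‖η‖ ^ 2 - 1)| := by
  have h1 : ¬ p ≤ 1 := fun h => by
    have := hp.trans h
    exact absurd this (by decide)
  unfold discR
  rw [if_neg (by tauto), norm_mul, Complex.norm_real, Real.norm_eq_abs, abs_mul, abs_pow, abs_norm]
  congr 1
  split_ifs with h
  · rw [max_eq_left h, min_eq_right h, norm_pow]
  · rw [max_eq_right (by omega), min_eq_left (by omega), norm_pow, RCLike.norm_conj]

lemma norm_discR_le_one {p : ℕ∞} (hp : 2 ≤ p) (k l : ℕ) {η : ℂ} (hη : ‖η‖ ≤ 1) :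
    ‖discR p k l η‖ ≤ 1 := by
  by_cases hp' : p = ⊤
  · subst hp'
    rw [norm_discR_top]
    exact pow_le_one₀ (norm_nonneg _) hη
  · rw [norm_discR_of_ne_top hp hp']
    exact abs_mul_jacobiR_le _ _ _ _
      (fun n => abs_pow_mul_jacobiR_zero_le_one _ (norm_nonneg _) hη _ n) _ _

/-- Disc polynomials tend to zero at interior points as `|k - l|` grows, uniformly otherwise. -/
lemma norm_discR_small {p : ℕ∞} (hp : 2 ≤ p) {η : ℂ} (hη : ‖η‖ < 1) {ε : ℝ} (hε : 0 < ε) :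
    ∃ D : ℕ, ∀ k l : ℕ, (D : ℤ) ≤ |(k : ℤ) - l| → ‖discR p k l η‖ ≤ ε := by
  have hd : ∀ k l : ℕ, |(k : ℤ) - l| = ((max k l - min k l : ℕ) : ℤ) := by
    intro k l
    rcases le_total k l with h | h
    · rw [max_eq_right h, min_eq_left h, abs_of_nonpos (by omega)]; omega
    · rw [max_eq_left h, min_eq_right h, abs_of_nonneg (by omega)]; omega
  by_cases hp' : p = ⊤
  · subst hp'
    obtain ⟨D, hD⟩ := exists_pow_lt_of_lt_one hε hη
    refine ⟨D, fun k l h => ?_⟩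
    rw [norm_discR_top]
    refine (pow_le_pow_of_le_one (norm_nonneg _) hη.le ?_).trans hD.le
    rw [hd] at h
    omega
  · obtain ⟨D, hD⟩ := abs_pow_mul_jacobiR_zero_small ‖η‖ (norm_nonneg _) hη hε
    refine ⟨D, fun k l h => ?_⟩
    rw [norm_discR_of_ne_top hp hp']
    rw [hd] at h
    exact abs_mul_jacobiR_le _ _ _ _ (hD _ (by exact_mod_cast h)) _ _

lemma conj_eq_inv_of_norm_one {u : ℂ} (hu : ‖u‖ = 1) : (starRingEnd ℂ) u = u⁻¹ := by
  rw [Complex.inv_def, Complex.normSq_eq_norm_sq, hu]; simp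

lemma discR_smul {p : ℕ∞} (k l : ℕ) {u : ℂ} (hu : ‖u‖ = 1) (η : ℂ) :
    discR p k l (u * η) = u ^ ((k : ℤ) - l) * discR p k l η := by
  have hu0 : u ≠ 0 := by rintro rfl; simp at hu
  unfold discR
  rw [map_mul, conj_eq_inv_of_norm_one hu, norm_mul, hu, one_mul]
  split_ifs with h h'
  · rw [zpow_sub₀ hu0, mul_pow, mul_pow, zpow_natCast, zpow_natCast, inv_pow, div_eq_mul_inv]
    ring
  · rw [mul_pow, ← zpow_natCast u, Nat.cast_sub h', mul_assoc]
  · rw [mul_pow, inv_pow, ← zpow_natCast u, ← zpow_neg, Nat.cast_sub (by omega), neg_sub, mul_assoc]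

lemma discR_one (p : ℕ∞) (k l : ℕ) : discR p k l 1 = 1 := by
  unfold discR
  have : (2 * ‖(1 : ℂ)‖ ^ 2 - 1) = 1 := by norm_num
  rw [this, jacobiR_one]
  simp

/-! ### Exponential sums -/

lemma isJacobsonRing_int : IsJacobsonRing ℤ := by
  rw [isJacobsonRing_iff_prime_eq]
  intro P hP
  by_cases h : P = ⊥
  · subst h
    rw [eq_bot_iff]
    intro x hx
    have h1 := Ideal.mem_jacobson_bot.1 hx x
    have h2 : x * x + 1 = 1 := by
      rcases Int.isUnit_iff.1 h1 with h | h
      · exact h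
      · nlinarith [mul_self_nonneg x]
    have h3 : x = 0 := by
      have : x * x = 0 := by linarith
      exact mul_self_eq_zero.1 this
    simp [h3]
  · have : P.IsMaximal := hP.isMaximal h
    exact Ideal.jacobson_eq_self_of_isMaximal

lemma finite_of_field_finiteType_int (K : Type*) [Field K] [inst : Algebra ℤ K]
    [Algebra.FiniteType ℤ K] : Finite K := by
  obtain rfl : inst = Ring.toIntAlgebra K := Subsingleton.elim _ _
  have := isJacobsonRing_int
  have hfin : Module.Finite ℤ K := finite_of_finite_type_of_isJacobsonRing ℤ K
  obtain ⟨q, hq⟩ := CharP.exists K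
  by_cases h0 : q = 0
  · subst h0
    have : CharZero K := CharP.charP_to_charZero K
    exact absurd (isField_of_isIntegral_of_isField (R := ℤ) (S := K)
      (by simpa using Int.cast_injective) (Field.toIsField K)) Int.not_isField
  · refine Module.finite_of_fg_torsion K fun x => ?_
    refine ⟨⟨(q : ℤ), mem_nonZeroDivisors_of_ne_zero (by exact_mod_cast h0)⟩, ?_⟩
    simp [Submonoid.smul_def]

/-- An exponential sum which is nonzero at a point of `ℤ²` is nonzero on a product of
arithmetic progressions through this point. -/
lemma exists_period_expSum_ne_zero {ι : Type*} [Fintype ι] (c u v : ι → ℂ) (hu : ∀ i, u i ≠ 0)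
    (hv : ∀ i, v i ≠ 0) (m₀ d₀ : ℤ) (h : ∑ i, c i * u i ^ m₀ * v i ^ d₀ ≠ 0) :
    ∃ q : ℕ, 0 < q ∧ ∀ m d : ℤ, (q : ℤ) ∣ m - m₀ → (q : ℤ) ∣ d - d₀ →
      ∑ i, c i * u i ^ m * v i ^ d ≠ 0 := by
  classical
  set S : Set ℂ := Set.range c ∪ (Set.range u ∪ Set.range fun i => (u i)⁻¹) ∪
    (Set.range v ∪ Set.range fun i => (v i)⁻¹) ∪ {(∑ i, c i * u i ^ m₀ * v i ^ d₀)⁻¹} with hS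
  have hSfin : S.Finite := by
    refine Set.Finite.union (Set.Finite.union (Set.Finite.union ?_ (Set.Finite.union ?_ ?_))
      (Set.Finite.union ?_ ?_)) (Set.finite_singleton _) <;> exact Set.finite_range _
  set R := Algebra.adjoin ℤ S
  have hmem : ∀ x ∈ S, x ∈ R := fun x hx => Algebra.subset_adjoin hx
  have hft : Algebra.FiniteType ℤ R :=
    (Subalgebra.fg_iff_finiteType R).1 (Subalgebra.fg_def.2 ⟨S, hSfin, rfl⟩)
  set c' : ι → R := fun i => ⟨c i, hmem _ (by simp [hS])⟩
  set u' : ι → Rˣ := fun i => ⟨⟨u i, hmem _ (by simp [hS])⟩, ⟨(u i)⁻¹, hmem _ (by simp [hS])⟩,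
    Subtype.ext (mul_inv_cancel₀ (hu i)), Subtype.ext (inv_mul_cancel₀ (hu i))⟩ with hu'
  set v' : ι → Rˣ := fun i => ⟨⟨v i, hmem _ (by simp [hS])⟩, ⟨(v i)⁻¹, hmem _ (by simp [hS])⟩,
    Subtype.ext (mul_inv_cancel₀ (hv i)), Subtype.ext (inv_mul_cancel₀ (hv i))⟩ with hv'
  set E : ℤ → ℤ → R := fun m d => ∑ i, c' i * ((u' i ^ m : Rˣ) : R) * ((v' i ^ d : Rˣ) : R) with hE
  have hval : ∀ m d, R.val (E m d) = ∑ i, c i * u i ^ m * v i ^ d := by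
    intro m d
    have hz : ∀ (w : Rˣ) (n : ℤ), R.val ((w ^ n : Rˣ) : R) = R.val (w : R) ^ n := by
      intro w n
      have := congrArg Units.val (map_zpow (Units.map (R.val : R →* ℂ)) w n)
      rw [Units.val_zpow_eq_zpow_val] at this
      exact this
    simp only [hE, map_sum, map_mul, hz]
    rfl
  obtain ⟨M, hM⟩ := Ideal.exists_maximal R
  let _ : Field (R ⧸ M) := Ideal.Quotient.field M
  have hft' : Algebra.FiniteType ℤ (R ⧸ M) :=
    hft.of_surjective (Ideal.Quotient.mkₐ ℤ M) (Ideal.Quotient.mkₐ_surjective ℤ M)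
  have hfinite : Finite (R ⧸ M) := finite_of_field_finiteType_int (R ⧸ M)
  have hunit : IsUnit (E m₀ d₀) := by
    refine IsUnit.of_mul_eq_one ⟨(∑ i, c i * u i ^ m₀ * v i ^ d₀)⁻¹, hmem _ (by simp [hS])⟩ ?_
    refine Subtype.ext ?_
    have := hval m₀ d₀
    change R.val (E m₀ d₀) * _ = 1
    rw [this]
    exact mul_inv_cancel₀ h
  set φ : R →+* R ⧸ M := Ideal.Quotient.mk M
  have hφ : φ (E m₀ d₀) ≠ 0 := (hunit.map φ).ne_zero
  refine ⟨Nat.card (R ⧸ M)ˣ, Nat.card_pos, ?_⟩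
  rintro m d ⟨a, ha⟩ ⟨b, hb⟩ hzero
  have hper : ∀ (w : Rˣ) (n n₀ e : ℤ), n - n₀ = (Nat.card (R ⧸ M)ˣ : ℤ) * e →
      φ ((w ^ n : Rˣ) : R) = φ ((w ^ n₀ : Rˣ) : R) := by
    intro w n n₀ e he
    have h1 : (Units.map (φ : R →* R ⧸ M) w) ^ n = (Units.map (φ : R →* R ⧸ M) w) ^ n₀ := by
      rw [show n = n₀ + (Nat.card (R ⧸ M)ˣ : ℤ) * e by linarith, zpow_add, zpow_mul, zpow_natCast,
        pow_card_eq_one', one_zpow, mul_one]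
    rw [← map_zpow, ← map_zpow] at h1
    exact congrArg Units.val h1
  refine hφ ?_
  have h2 : φ (E m d) = φ (E m₀ d₀) := by
    simp only [hE, map_sum, map_mul]
    refine Finset.sum_congr rfl fun i _ => ?_
    rw [hper (u' i) m m₀ a ha, hper (v' i) d d₀ b hb]
  rw [← h2]
  have h3 : E m d = 0 := Subtype.ext ((hval m d).trans hzero)
  rw [h3, map_zero]

/-- An exponential sum over distinct pairs with a nonzero coefficient does not vanish identically. -/
lemma exists_expSum_ne_zero {ι : Type*} [Fintype ι] (c u v : ι → ℂ) (hu : ∀ i, u i ≠ 0)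
    (hv : ∀ i, v i ≠ 0) (hinj : Function.Injective fun i => (u i, v i)) (hc : c ≠ 0) :
    ∃ m d : ℤ, ∑ i, c i * u i ^ m * v i ^ d ≠ 0 := by
  by_contra! hcon
  set χ : ι → (Multiplicative (ℤ × ℤ) →* ℂ) := fun i =>
    { toFun := fun g => u i ^ g.toAdd.1 * v i ^ g.toAdd.2
      map_one' := by simp
      map_mul' := fun a b => by
        simp only [toAdd_mul, Prod.fst_add, Prod.snd_add, zpow_add₀ (hu i), zpow_add₀ (hv i)]
        ring } with hχ
  have hχinj : Function.Injective χ := by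
    intro i j hij
    apply hinj
    have h1 := DFunLike.congr_fun hij (Multiplicative.ofAdd (1, 0))
    have h2 := DFunLike.congr_fun hij (Multiplicative.ofAdd (0, 1))
    simp [hχ] at h1 h2
    simp [h1, h2]
  have hli := (linearIndependent_monoidHom (Multiplicative (ℤ × ℤ)) ℂ).comp χ hχinj
  refine hc (funext fun i => ?_)
  refine Fintype.linearIndependent_iff.1 hli c ?_ i
  ext g
  have := hcon g.toAdd.1 g.toAdd.2
  simp only [Finset.sum_apply, Pi.smul_apply, smul_eq_mul, Pi.zero_apply, Function.comp]
  rw [← this]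
  exact Finset.sum_congr rfl fun i _ => (mul_assoc _ _ _).symm

/-! ### Positive definite kernels on finite families -/

lemma sum_mul_comp_eq_sum_fiber {ι J : Type*} [Fintype ι] [Fintype J] [DecidableEq J] (g : ι → J)
    (c : ι → ℂ) (H : J → ℂ) :
    ∑ μ, c μ * H (g μ) = ∑ a, (∑ μ with g μ = a, c μ) * H a := by
  rw [← Finset.sum_fiberwise Finset.univ g]
  refine Finset.sum_congr rfl fun a _ => ?_
  rw [Finset.sum_mul]
  refine Finset.sum_congr rfl fun μ hμ => ?_
  rw [(Finset.mem_filter.1 hμ).2]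

lemma sum_sum_comp_eq_sum_fiber {ι J : Type*} [Fintype ι] [Fintype J] [DecidableEq J] (g : ι → J)
    (c : ι → ℂ) (K : J → J → ℂ) :
    ∑ μ, ∑ ν, c μ * (starRingEnd ℂ) (c ν) * K (g μ) (g ν) =
      ∑ a, ∑ b, (∑ μ with g μ = a, c μ) * (starRingEnd ℂ) (∑ ν with g ν = b, c ν) * K a b := by
  have h1 : ∀ z : J, ∑ ν, (starRingEnd ℂ) (c ν) * K z (g ν) =
      ∑ b, (starRingEnd ℂ) (∑ ν with g ν = b, c ν) * K z b := by
    intro z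
    rw [sum_mul_comp_eq_sum_fiber g (fun ν => (starRingEnd ℂ) (c ν)) (K z)]
    simp only [map_sum]
  simp only [mul_assoc, ← Finset.mul_sum]
  simp only [h1]
  exact sum_mul_comp_eq_sum_fiber g c fun a =>
    ∑ b, (starRingEnd ℂ) (∑ ν with g ν = b, c ν) * K a b

lemma IsPDKernel.sum_nonneg {α ι : Type*} [Fintype ι] {S : Set α} {K : α → α → ℂ}
    (hK : IsPDKernel S K) (x : ι → α) (hx : ∀ i, x i ∈ S) (c : ι → ℂ) :
    0 ≤ ∑ μ, ∑ ν, c μ * (starRingEnd ℂ) (c ν) * K (x μ) (x ν) := by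
  classical
  set T := Finset.univ.image x
  have hmem : ∀ i, x i ∈ T := fun i => Finset.mem_image_of_mem x (Finset.mem_univ i)
  have hT : ∀ y ∈ T, y ∈ S := by
    intro y hy
    obtain ⟨i, -, rfl⟩ := Finset.mem_image.1 hy
    exact hx i
  set g : ι → Fin T.card := fun i => T.equivFin ⟨x i, hmem i⟩ with hg
  set y : Fin T.card → α := fun a => (T.equivFin.symm a : α)
  have hxy : ∀ i, x i = y (g i) := fun i => by simp [y, hg]
  simp only [hxy]
  rw [sum_sum_comp_eq_sum_fiber g c fun a b => K (y a) (y b)]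
  exact hK _ y (fun a => hT _ (T.equivFin.symm a).2)
    (Subtype.val_injective.comp T.equivFin.symm.injective) _

lemma IsSPDKernel.eq_zero {α ι : Type*} [Fintype ι] {S : Set α} {K : α → α → ℂ}
    (hK : IsSPDKernel S K) (x : ι → α) (hx : ∀ i, x i ∈ S) (hinj : Function.Injective x)
    (c : ι → ℂ) (h : ∑ μ, ∑ ν, c μ * (starRingEnd ℂ) (c ν) * K (x μ) (x ν) = 0) : c = 0 := by
  set e := Fintype.equivFin ι
  have := hK.2 _ (x ∘ e.symm) (fun i => hx _) (hinj.comp e.symm.injective) (c ∘ e.symm) (by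
    rw [← h, ← e.symm.sum_comp]
    refine Finset.sum_congr rfl fun μ _ => ?_
    rw [← e.symm.sum_comp]
    rfl)
  funext i
  simpa using congrFun this (e i)

/-- A Hermitian form close to the identity is bounded below. -/
lemma half_sum_sq_le_re_of_offDiag_small {J : Type*} [Fintype J] [DecidableEq J] (C : J → ℂ)
    (K : J → J → ℂ) (hd : ∀ a, K a a = 1) {ε : ℝ} (hε0 : 0 ≤ ε)
    (hε : ε * Fintype.card J ≤ 1 / 2) (ho : ∀ a b, a ≠ b → ‖K a b‖ ≤ ε) :
    1 / 2 * ∑ a, ‖C a‖ ^ 2 ≤ (∑ a, ∑ b, C a * (starRingEnd ℂ) (C b) * K a b).re := by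
  have hsplit : ∑ a, ∑ b, C a * (starRingEnd ℂ) (C b) * K a b =
      ((∑ a, ‖C a‖ ^ 2 : ℝ) : ℂ) +
        ∑ a, ∑ b, C a * (starRingEnd ℂ) (C b) * (if a = b then 0 else K a b) := by
    push_cast
    rw [← Finset.sum_add_distrib]
    refine Finset.sum_congr rfl fun a _ => ?_
    have h1 : (‖C a‖ : ℂ) ^ 2 = ∑ b, if a = b then C a * (starRingEnd ℂ) (C b) else 0 := by
      rw [Finset.sum_ite_eq, if_pos (Finset.mem_univ _), Complex.mul_conj, Complex.normSq_eq_norm_sq]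
      push_cast; rfl
    rw [h1, ← Finset.sum_add_distrib]
    refine Finset.sum_congr rfl fun b _ => ?_
    split_ifs with hab
    · subst hab; rw [hd]; ring
    · ring
  have hnorm : ‖∑ a, ∑ b, C a * (starRingEnd ℂ) (C b) * (if a = b then 0 else K a b)‖ ≤
      ε * (∑ a, ‖C a‖) ^ 2 := by
    rw [sq, Finset.sum_mul_sum, Finset.mul_sum]
    refine (norm_sum_le _ _).trans (Finset.sum_le_sum fun a _ => ?_)
    rw [Finset.mul_sum]
    refine (norm_sum_le _ _).trans (Finset.sum_le_sum fun b _ => ?_)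
    rw [norm_mul, norm_mul, RCLike.norm_conj, mul_comm]
    refine mul_le_mul_of_nonneg_right ?_ (by positivity)
    split_ifs with hab
    · simpa using hε0
    · exact ho a b hab
  have hcs : (∑ a, ‖C a‖) ^ 2 ≤ Fintype.card J * ∑ a, ‖C a‖ ^ 2 := by
    simpa using sq_sum_le_card_mul_sum_sq (s := Finset.univ) (f := fun a => ‖C a‖)
  have hs0 : 0 ≤ ∑ a, ‖C a‖ ^ 2 := Finset.sum_nonneg fun _ _ => by positivity
  have h2 : ε * (∑ a, ‖C a‖) ^ 2 ≤ 1 / 2 * ∑ a, ‖C a‖ ^ 2 := by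
    calc ε * (∑ a, ‖C a‖) ^ 2 ≤ ε * (Fintype.card J * ∑ a, ‖C a‖ ^ 2) := by gcongr
      _ = ε * Fintype.card J * ∑ a, ‖C a‖ ^ 2 := by ring
      _ ≤ _ := by gcongr
  rw [hsplit, Complex.add_re, Complex.ofReal_re]
  have h3 := (abs_le.1 ((Complex.abs_re_le_norm _).trans (hnorm.trans h2))).1
  linarith

/-! ### Points of the spheres -/

lemma hdot_smul_smul (u v : ℂ) (z w : Ell2) :
    hdot (u • z) (v • w) = u * (starRingEnd ℂ) v * hdot z w := by
  unfold hdot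
  rw [inner_smul_left, inner_smul_right]; ring

lemma norm_hdot_le_one {q : ℕ∞} {z w : Ell2} (hz : z ∈ Omega q) (hw : w ∈ Omega q) :
    ‖hdot z w‖ ≤ 1 := by
  have := norm_inner_le_norm (𝕜 := ℂ) w z
  rwa [hz.1, hw.1, one_mul] at this

lemma hdot_self {q : ℕ∞} {z : Ell2} (hz : z ∈ Omega q) : hdot z z = 1 := by
  unfold hdot
  rw [inner_self_eq_norm_sq_to_K, hz.1]; simp

lemma smul_mem_Omega {q : ℕ∞} {z : Ell2} (hz : z ∈ Omega q) {u : ℂ} (hu : ‖u‖ = 1) :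
    u • z ∈ Omega q := by
  refine ⟨by rw [norm_smul, hu, hz.1, one_mul], fun j hj => ?_⟩
  rw [lp.coeFn_smul, Pi.smul_apply, hz.2 j hj, smul_zero]

lemma hdot_of_mem_Omega_one {z w : Ell2} (hw : w ∈ Omega 1) :
    hdot z w = z 0 * (starRingEnd ℂ) (w 0) := by
  unfold hdot
  rw [lp.inner_eq_tsum, tsum_eq_single 0]
  · simp
  · intro j hj
    rw [hw.2 j (by exact_mod_cast Nat.one_le_iff_ne_zero.2 hj), inner_zero_left]

lemma norm_apply_zero_of_mem_Omega_one {z : Ell2} (hz : z ∈ Omega 1) : ‖z 0‖ = 1 := by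
  have h := (hdot_of_mem_Omega_one (z := z) hz).symm.trans (hdot_self hz)
  have h2 := congrArg norm h
  rw [norm_mul, RCLike.norm_conj, norm_one] at h2
  nlinarith [norm_nonneg (z 0)]

lemma norm_hdot_Omega_one {z w : Ell2} (hz : z ∈ Omega 1) (hw : w ∈ Omega 1) :
    ‖hdot z w‖ = 1 := by
  rw [hdot_of_mem_Omega_one hw, norm_mul, RCLike.norm_conj, norm_apply_zero_of_mem_Omega_one hz,
    norm_apply_zero_of_mem_Omega_one hw, one_mul]

lemma eq_of_mem_Omega_one {z w : Ell2} (hz : z ∈ Omega 1) (hw : w ∈ Omega 1) (h : z 0 = w 0) :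
    z = w := by
  ext j
  rcases Nat.eq_zero_or_pos j with rfl | hj
  · exact h
  · rw [hz.2 j (by exact_mod_cast hj), hw.2 j (by exact_mod_cast hj)]

lemma exists_smul_eq_of_norm_hdot {q : ℕ∞} {z w : Ell2} (hz : z ∈ Omega q) (hw : w ∈ Omega q)
    (h : ‖hdot z w‖ = 1) : ∃ u : ℂ, ‖u‖ = 1 ∧ z = u • w := by
  have hz0 : z ≠ 0 := by rintro rfl; simpa using hz.1
  have hw0 : w ≠ 0 := by rintro rfl; simpa using hw.1
  obtain ⟨u, -, hu⟩ := (norm_inner_eq_norm_iff (𝕜 := ℂ) hw0 hz0).1 (by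
    rw [hz.1, hw.1, one_mul]; exact h)
  refine ⟨u, ?_, hu⟩
  have := congrArg norm hu
  rw [norm_smul, hz.1, hw.1, mul_one] at this
  exact this.symm

lemma exists_mem_Omega {q : ℕ∞} (hq : 1 ≤ q) : ∃ z : Ell2, z ∈ Omega q := by
  refine ⟨lp.single 2 0 (1 : ℂ), ?_, fun j hj => ?_⟩
  · rw [lp.norm_single (by norm_num)]; simp
  · have : j ≠ 0 := by
      rintro rfl
      have := hq.trans hj
      simp at this
    rw [lp.single_apply]
    simp [this]

/-! ### Quadratic forms of the elementary kernels -/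

/-- The quadratic form of the kernel `ξ^m R_{k,l}(η)`. -/
def kform (p : ℕ∞) (i : ℤ × ℕ × ℕ) {ι : Type*} [Fintype ι] (x : ι → Ell2 × Ell2) (c : ι → ℂ) : ℂ :=
  ∑ μ, ∑ ν, c μ * (starRingEnd ℂ) (c ν) *
    (hdot (x μ).1 (x ν).1 ^ i.1 * discR p i.2.1 i.2.2 (hdot (x μ).2 (x ν).2))

lemma hasSum_form {p : ℕ∞} (hp : 2 ≤ p) {f : ℂ → ℂ → ℂ} {a : ℤ × ℕ × ℕ → ℝ} (ha0 : ∀ i, 0 ≤ a i)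
    (haS : Summable a)
    (hexp : ∀ ξ ∈ Metric.sphere (0 : ℂ) 1, ∀ η ∈ Metric.closedBall (0 : ℂ) 1,
      f ξ η = ∑' i : ℤ × ℕ × ℕ, (a i : ℂ) * ξ ^ i.1 * discR p i.2.1 i.2.2 η)
    {ι : Type*} [Fintype ι] (x : ι → Ell2 × Ell2) (hx : ∀ i, x i ∈ Omega 1 ×ˢ Omega p)
    (c : ι → ℂ) :
    HasSum (fun i => (a i : ℂ) * kform p i x c)
      (∑ μ, ∑ ν, c μ * (starRingEnd ℂ) (c ν) *
        f (hdot (x μ).1 (x ν).1) (hdot (x μ).2 (x ν).2)) := by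
  have hterm : ∀ μ ν, HasSum (fun i : ℤ × ℕ × ℕ => c μ * (starRingEnd ℂ) (c ν) *
      ((a i : ℂ) * hdot (x μ).1 (x ν).1 ^ i.1 * discR p i.2.1 i.2.2 (hdot (x μ).2 (x ν).2)))
      (c μ * (starRingEnd ℂ) (c ν) * f (hdot (x μ).1 (x ν).1) (hdot (x μ).2 (x ν).2)) := by
    intro μ ν
    have h1 := norm_hdot_Omega_one (hx μ).1 (hx ν).1
    have h2 := norm_hdot_le_one (hx μ).2 (hx ν).2
    rw [hexp _ (by simpa using h1) _ (by simpa using h2)]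
    refine HasSum.mul_left _ (Summable.hasSum ?_)
    refine Summable.of_norm_bounded haS fun i => ?_
    rw [norm_mul, norm_mul, norm_zpow, h1, one_zpow, mul_one, Complex.norm_real,
      Real.norm_of_nonneg (ha0 i)]
    exact mul_le_of_le_one_right (ha0 i) (norm_discR_le_one hp _ _ h2)
  convert hasSum_sum fun μ _ => hasSum_sum fun ν _ => hterm μ ν using 1
  funext i
  unfold kform
  simp only [Finset.mul_sum]
  refine Finset.sum_congr rfl fun μ _ => Finset.sum_congr rfl fun ν _ => ?_
  ring

/-! ### Averaging over roots of unity -/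

lemma kform_phase {p : ℕ∞} (i : ℤ × ℕ × ℕ) {ι τ : Type*} [Fintype ι] [Fintype τ]
    (x : ι → Ell2 × Ell2) (c : ι → ℂ) (α β γ : τ → ℂ)
    (hβ : ∀ g, ‖β g‖ = 1) :
    kform p i (fun j : ι × τ => (α j.2 • (x j.1).1, β j.2 • (x j.1).2))
        (fun j => c j.1 * γ j.2) =
      (∑ g, γ g * α g ^ i.1 * β g ^ ((i.2.1 : ℤ) - i.2.2)) *
        (starRingEnd ℂ) (∑ g, γ g * α g ^ i.1 * β g ^ ((i.2.1 : ℤ) - i.2.2)) *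
        kform p i x c := by
  have hconj : ∀ u v : ℂ, ‖u‖ = 1 → ‖v‖ = 1 → ‖u * (starRingEnd ℂ) v‖ = 1 := by
    intro u v hu hv
    rw [norm_mul, RCLike.norm_conj, hu, hv, one_mul]
  set G : τ → ℂ := fun g => γ g * α g ^ i.1 * β g ^ ((i.2.1 : ℤ) - i.2.2) with hG
  have hterm : ∀ (μ ν : ι) (g h : τ),
      c μ * γ g * (starRingEnd ℂ) (c ν * γ h) *
        (hdot (α g • (x μ).1) (α h • (x ν).1) ^ i.1 *
          discR p i.2.1 i.2.2 (hdot (β g • (x μ).2) (β h • (x ν).2))) =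
      c μ * (starRingEnd ℂ) (c ν) * (hdot (x μ).1 (x ν).1 ^ i.1 *
        discR p i.2.1 i.2.2 (hdot (x μ).2 (x ν).2)) * (G g * (starRingEnd ℂ) (G h)) := by
    intro μ ν g h
    rw [hdot_smul_smul, hdot_smul_smul, discR_smul _ _ (hconj _ _ (hβ g) (hβ h)), mul_zpow,
      mul_zpow, mul_zpow]
    simp only [hG, map_mul, map_zpow₀]
    ring
  unfold kform
  simp only [Fintype.sum_prod_type, hterm, map_sum]
  rw [Finset.sum_mul_sum, Finset.mul_sum]
  refine Finset.sum_congr rfl fun μ _ => ?_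
  rw [Finset.sum_comm' (t' := Finset.univ) (s' := fun _ => Finset.univ) (by simp), Finset.mul_sum]
  refine Finset.sum_congr rfl fun ν _ => ?_
  simp only [← Finset.mul_sum]
  ring

lemma sum_stdAddChar_eq {N : ℕ} [NeZero N] (r s : ZMod N) (m d : ℤ) :
    ∑ g : ZMod N × ZMod N, ZMod.stdAddChar (-(r * g.1) - s * g.2) *
        (ZMod.stdAddChar g.1 : ℂ) ^ m * (ZMod.stdAddChar g.2 : ℂ) ^ d =
      if (m : ZMod N) = r ∧ (d : ZMod N) = s then (N : ℂ) ^ 2 else 0 := by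
  have h1 : ∀ g : ZMod N × ZMod N, ZMod.stdAddChar (-(r * g.1) - s * g.2) *
        (ZMod.stdAddChar g.1 : ℂ) ^ m * (ZMod.stdAddChar g.2 : ℂ) ^ d =
      ZMod.stdAddChar (g.1 * ((m : ZMod N) - r)) * ZMod.stdAddChar (g.2 * ((d : ZMod N) - s)) := by
    intro g
    rw [← AddChar.map_zsmul_eq_zpow, ← AddChar.map_zsmul_eq_zpow, ← AddChar.map_add_eq_mul,
      ← AddChar.map_add_eq_mul, ← AddChar.map_add_eq_mul, zsmul_eq_mul, zsmul_eq_mul]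
    congr 1
    ring
  simp only [h1, Fintype.sum_prod_type, ← Finset.mul_sum, ← Finset.sum_mul]
  rw [AddChar.sum_mulShift _ (ZMod.isPrimitive_stdAddChar N),
    AddChar.sum_mulShift _ (ZMod.isPrimitive_stdAddChar N), ZMod.card]
  simp only [sub_eq_zero]
  split_ifs <;> simp_all [sq]

/-- The family obtained by rotating both components of `x` by all `N`-th roots of unity. -/
def rotPts {ι : Type*} (N : ℕ) [NeZero N] (x : ι → Ell2 × Ell2) (j : ι × ZMod N × ZMod N) :
    Ell2 × Ell2 :=
  ((ZMod.stdAddChar j.2.1 : ℂ) • (x j.1).1, (ZMod.stdAddChar j.2.2 : ℂ) • (x j.1).2)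

/-- The coefficients on `rotPts` which project onto the frequencies `(r, s)` modulo `N`. -/
def phaseCoeff {ι : Type*} {N : ℕ} [NeZero N] (r s : ZMod N) (c : ι → ℂ)
    (j : ι × ZMod N × ZMod N) : ℂ :=
  c j.1 * ZMod.stdAddChar (-(r * j.2.1) - s * j.2.2)

lemma kform_rotPts {p : ℕ∞} (i : ℤ × ℕ × ℕ) {ι : Type*} [Fintype ι] {N : ℕ} [NeZero N]
    (x : ι → Ell2 × Ell2) (c : ι → ℂ) (r s : ZMod N) :
    kform p i (rotPts N x) (phaseCoeff r s c) =
      if (i.1 : ZMod N) = r ∧ (((i.2.1 : ℤ) - i.2.2 : ℤ) : ZMod N) = s then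
        (N : ℂ) ^ 4 * kform p i x c else 0 := by
  have h := kform_phase (p := p) i x c (fun g : ZMod N × ZMod N => (ZMod.stdAddChar g.1 : ℂ))
    (fun g => ZMod.stdAddChar g.2) (fun g => ZMod.stdAddChar (-(r * g.1) - s * g.2))
    (fun g => AddChar.norm_apply _ _)
  rw [sum_stdAddChar_eq] at h
  refine h.trans ?_
  split_ifs
  · rw [map_pow, Complex.conj_natCast]; ring
  · simp

lemma rotPts_mem {p : ℕ∞} {ι : Type*} {N : ℕ} [NeZero N] {x : ι → Ell2 × Ell2}
    (hx : ∀ i, x i ∈ Omega 1 ×ˢ Omega p) (j : ι × ZMod N × ZMod N) :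
    rotPts N x j ∈ Omega 1 ×ˢ Omega p :=
  ⟨smul_mem_Omega (hx _).1 (AddChar.norm_apply _ _), smul_mem_Omega (hx _).2 (AddChar.norm_apply _ _)⟩

lemma rotPts_injective {p : ℕ∞} {N : ℕ} [NeZero N] {x : Unit → Ell2 × Ell2}
    (hx : ∀ i, x i ∈ Omega 1 ×ˢ Omega p) : Function.Injective (rotPts N x) := by
  have h0 : ∀ {q : ℕ∞} {z : Ell2}, z ∈ Omega q → z ≠ 0 := by
    rintro q z hz rfl
    simpa using hz.1
  rintro ⟨⟨⟩, s, t⟩ ⟨⟨⟩, s', t'⟩ h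
  have h1 := smul_left_injective ℂ (h0 (hx ()).1) (congrArg Prod.fst h)
  have h2 := smul_left_injective ℂ (h0 (hx ()).2) (congrArg Prod.snd h)
  obtain rfl : s = s' := ZMod.injective_stdAddChar h1
  obtain rfl : t = t' := ZMod.injective_stdAddChar h2
  rfl

/-! ### Necessity -/

lemma meetsAllProgressions_of_SPD {p : ℕ∞} (hp : 2 ≤ p) {f : ℂ → ℂ → ℂ} {a : ℤ × ℕ × ℕ → ℝ}
    (ha0 : ∀ i, 0 ≤ a i) (haS : Summable a)
    (hexp : ∀ ξ ∈ Metric.sphere (0 : ℂ) 1, ∀ η ∈ Metric.closedBall (0 : ℂ) 1,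
      f ξ η = ∑' i : ℤ × ℕ × ℕ, (a i : ℂ) * ξ ^ i.1 * discR p i.2.1 i.2.2 η)
    (hS : SPDonProd 1 p f) :
    MeetsAllProgressions {v : ℤ × ℤ | ∃ (m : ℤ) (k l : ℕ), 0 < a (m, k, l) ∧
      v = (m, (k : ℤ) - (l : ℤ))} := by
  intro N M x y hN hM _ _
  by_contra hcon
  obtain ⟨z, hz⟩ := exists_mem_Omega (q := 1) le_rfl
  obtain ⟨w, hw⟩ := exists_mem_Omega (q := p) (le_trans (by norm_num) hp)
  set n : ℕ := (N * M).toNat with hn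
  have hnN : (n : ℤ) = N * M := Int.toNat_of_nonneg (by positivity)
  have : NeZero n := ⟨by
    have : 0 < N * M := by positivity
    omega⟩
  set b : Unit → Ell2 × Ell2 := fun _ => (z, w)
  have hb : ∀ i, b i ∈ Omega 1 ×ˢ Omega p := fun _ => ⟨hz, hw⟩
  have hsum := hasSum_form hp ha0 haS hexp (rotPts n b) (rotPts_mem hb)
    (phaseCoeff (x : ZMod n) (y : ZMod n) fun _ => 1)
  have hzero : ∀ i : ℤ × ℕ × ℕ,
      (a i : ℂ) * kform p i (rotPts n b) (phaseCoeff (x : ZMod n) (y : ZMod n) fun _ => 1) = 0 := by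
    rintro ⟨m, k, l⟩
    rw [kform_rotPts]
    split_ifs with h
    · have hx := (ZMod.intCast_eq_intCast_iff_dvd_sub _ _ _).1 h.1.symm
      have hy := (ZMod.intCast_eq_intCast_iff_dvd_sub _ _ _).1 h.2.symm
      rw [hnN] at hx hy
      obtain ⟨s, hs⟩ := (Dvd.intro _ rfl : N ∣ N * M).trans hx
      obtain ⟨t, ht⟩ := (Dvd.intro_left _ rfl : M ∣ N * M).trans hy
      have : a (m, k, l) = 0 := by
        refine ((ha0 _).eq_or_lt.resolve_right fun hpos => hcon ?_).symm
        exact ⟨(m, (k : ℤ) - l), ⟨m, k, l, hpos, rfl⟩, ⟨s, by linarith⟩, ⟨t, by linarith⟩⟩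
      rw [this]; simp
    · simp
  simp only [hzero] at hsum
  have h0 := IsSPDKernel.eq_zero hS (rotPts n b) (rotPts_mem hb) (rotPts_injective hb) _
    (hsum.unique hasSum_zero)
  have := congrFun h0 ((), 0, 0)
  simp [phaseCoeff] at this

/-! ### Sufficiency -/

/-- If a quadratic form of a positive definite kernel vanishes, so does its part with
frequencies in any given residue class. -/
lemma hasSum_residue_class_zero {p : ℕ∞} (hp : 2 ≤ p) {f : ℂ → ℂ → ℂ} (hPD : PDonProd 1 p f)
    {a : ℤ × ℕ × ℕ → ℝ} (ha0 : ∀ i, 0 ≤ a i) (haS : Summable a)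
    (hexp : ∀ ξ ∈ Metric.sphere (0 : ℂ) 1, ∀ η ∈ Metric.closedBall (0 : ℂ) 1,
      f ξ η = ∑' i : ℤ × ℕ × ℕ, (a i : ℂ) * ξ ^ i.1 * discR p i.2.1 i.2.2 η)
    {ι : Type*} [Fintype ι] (x : ι → Ell2 × Ell2) (hx : ∀ i, x i ∈ Omega 1 ×ˢ Omega p)
    (c : ι → ℂ)
    (h0 : ∑ μ, ∑ ν, c μ * (starRingEnd ℂ) (c ν) *
        f (hdot (x μ).1 (x ν).1) (hdot (x μ).2 (x ν).2) = 0)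
    {N : ℕ} [NeZero N] (r s : ZMod N) :
    HasSum (fun i : ℤ × ℕ × ℕ => (a i : ℂ) *
      if (i.1 : ZMod N) = r ∧ (((i.2.1 : ℤ) - i.2.2 : ℤ) : ZMod N) = s then
        kform p i x c else 0) 0 := by
  set F : ZMod N × ZMod N → ℂ := fun g => ∑ μ, ∑ ν, phaseCoeff g.1 g.2 c μ *
    (starRingEnd ℂ) (phaseCoeff g.1 g.2 c ν) *
      f (hdot (rotPts N x μ).1 (rotPts N x ν).1) (hdot (rotPts N x μ).2 (rotPts N x ν).2) with hF
  have hF0 : ∀ g, 0 ≤ F g := fun g =>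
    IsPDKernel.sum_nonneg hPD (rotPts N x) (rotPts_mem hx) (phaseCoeff g.1 g.2 c)
  have hFs : ∀ g, HasSum (fun i => (a i : ℂ) * kform p i (rotPts N x) (phaseCoeff g.1 g.2 c)) (F g) :=
    fun g => hasSum_form hp ha0 haS hexp (rotPts N x) (rotPts_mem hx) _
  have hN : (N : ℂ) ≠ 0 := Nat.cast_ne_zero.2 (NeZero.ne N)
  have htot : ∑ g, F g = 0 := by
    have h1 := hasSum_sum fun g (_ : g ∈ Finset.univ) => hFs g
    have h2 := (hasSum_form hp ha0 haS hexp x hx c).mul_left ((N : ℂ) ^ 4)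
    rw [h0, mul_zero] at h2
    refine h1.unique ?_
    refine HasSum.congr_fun h2 fun i => ?_
    simp only [kform_rotPts, ← Finset.mul_sum, Fintype.sum_prod_type, ite_and]
    simp only [Finset.sum_ite_eq, Finset.mem_univ, if_true, Finset.sum_ite_irrel,
      Finset.sum_const_zero]
    ring
  have hFz : F (r, s) = 0 :=
    (Finset.sum_eq_zero_iff_of_nonneg fun g _ => hF0 g).1 htot _ (Finset.mem_univ _)
  have h3 := (hFs (r, s)).mul_left (((N : ℂ) ^ 4)⁻¹)
  rw [hFz, mul_zero] at h3
  refine HasSum.congr_fun h3 fun i => ?_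
  rw [kform_rotPts]
  split_ifs
  · field_simp
  · simp

lemma kform_eq_sum_fiber {p : ℕ∞} (i : ℤ × ℕ × ℕ) {ι J : Type*} [Fintype ι] [Fintype J]
    [DecidableEq J] (x : ι → Ell2 × Ell2) (hx : ∀ μ, (x μ).1 ∈ Omega 1) (c : ι → ℂ) (g : ι → J)
    (W : J → Ell2) (u : ι → ℂ) (hu : ∀ μ, ‖u μ‖ = 1) (hW : ∀ μ, (x μ).2 = u μ • W (g μ)) :
    kform p i x c = ∑ a, ∑ b,
      (∑ μ with g μ = a, c μ * (x μ).1 0 ^ i.1 * u μ ^ ((i.2.1 : ℤ) - i.2.2)) *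
        (starRingEnd ℂ)
          (∑ ν with g ν = b, c ν * (x ν).1 0 ^ i.1 * u ν ^ ((i.2.1 : ℤ) - i.2.2)) *
        discR p i.2.1 i.2.2 (hdot (W a) (W b)) := by
  rw [← sum_sum_comp_eq_sum_fiber g (fun μ => c μ * (x μ).1 0 ^ i.1 * u μ ^ ((i.2.1 : ℤ) - i.2.2))
    (fun a b => discR p i.2.1 i.2.2 (hdot (W a) (W b)))]
  unfold kform
  refine Finset.sum_congr rfl fun μ _ => Finset.sum_congr rfl fun ν _ => ?_
  rw [hdot_of_mem_Omega_one (hx ν), hW μ, hW ν, hdot_smul_smul,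
    discR_smul _ _ (by rw [norm_mul, RCLike.norm_conj, hu, hu, one_mul]), mul_zpow, mul_zpow]
  simp only [map_mul, map_zpow₀]
  ring

lemma le_abs_and_dvd_sub {q D : ℕ} (hq : 0 < q) {d₀ d : ℤ}
    (h : ((q * (2 * D + 2) : ℕ) : ℤ) ∣ d - (d₀ % q + q * D + (q * (2 * D + 2) : ℕ))) :
    (D : ℤ) ≤ |d| ∧ (q : ℤ) ∣ d - d₀ := by
  obtain ⟨t, ht⟩ := h
  push_cast at ht
  have hq' : (1 : ℤ) ≤ q := by exact_mod_cast hq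
  have hD : (0 : ℤ) ≤ D := Nat.cast_nonneg D
  have h1 := Int.emod_nonneg d₀ (by omega : (q : ℤ) ≠ 0)
  have h2 := Int.emod_lt_of_pos d₀ (by omega : (0 : ℤ) < q)
  have hqD : (D : ℤ) ≤ q * D := le_mul_of_one_le_left hD hq'
  constructor
  · rcases le_or_gt (-1) t with h | h
    · have : 0 ≤ (q : ℤ) * (2 * D + 2) * (t + 1) := by
        have : 0 ≤ t + 1 := by omega
        positivity
      exact le_trans (by linarith) (le_abs_self d)
    · have : 0 ≤ (q : ℤ) * (2 * D + 2) * (-2 - t) := by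
        have : 0 ≤ -2 - t := by omega
        positivity
      exact le_trans (by linarith) (neg_le_abs d)
  · have h3 := Int.emod_add_mul_ediv d₀ q
    exact ⟨(2 * D + 2) * t + D + (2 * D + 2) - d₀ / q, by linear_combination ht + h3⟩

/-- Grouping points by the complex line they span. -/
lemma exists_line_decomposition {ι : Type} [Fintype ι] {q : ℕ∞} (w : ι → Ell2)
    (hw : ∀ μ, w μ ∈ Omega q) :
    ∃ (J : Type) (_ : Fintype J) (_ : DecidableEq J) (g : ι → J) (W : J → Ell2) (u : ι → ℂ),
      (∀ a, W a ∈ Omega q) ∧ (∀ μ, ‖u μ‖ = 1) ∧ (∀ μ, w μ = u μ • W (g μ)) ∧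
        ∀ a b, a ≠ b → ‖hdot (W a) (W b)‖ < 1 := by
  classical
  let S : Setoid ι :=
    { r := fun μ ν => ∃ u : ℂ, ‖u‖ = 1 ∧ w μ = u • w ν
      iseqv :=
        { refl := fun μ => ⟨1, by simp, by simp⟩
          symm := by
            rintro μ ν ⟨u, hu, h⟩
            have hu0 : u ≠ 0 := by rintro rfl; simp at hu
            exact ⟨u⁻¹, by simp [hu], by rw [h, inv_smul_smul₀ hu0]⟩
          trans := by
            rintro μ ν κ ⟨u, hu, h⟩ ⟨v, hv, h'⟩
            exact ⟨u * v, by simp [hu, hv], by rw [h, h', mul_smul]⟩ } }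
  have hout : ∀ μ, ∃ u : ℂ, ‖u‖ = 1 ∧ w μ = u • w (Quotient.out (Quotient.mk S μ)) := fun μ =>
    S.symm (Quotient.mk_out μ)
  choose u hu hwu using hout
  refine ⟨Quotient S, inferInstance, inferInstance, Quotient.mk S, fun a => w a.out, u,
    fun a => hw _, hu, hwu, fun a b hab => ?_⟩
  refine (norm_hdot_le_one (hw _) (hw _)).lt_of_ne fun h => hab ?_
  exact Quotient.out_equiv_out.1 (exists_smul_eq_of_norm_hdot (hw _) (hw _) h)

lemma exists_uniform_decay {p : ℕ∞} (hp : 2 ≤ p) {J : Type*} [Fintype J] (W : J → Ell2)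
    (hW : ∀ a b, a ≠ b → ‖hdot (W a) (W b)‖ < 1) {ε : ℝ} (hε : 0 < ε) :
    ∃ D : ℕ, ∀ a b, a ≠ b → ∀ k l : ℕ, (D : ℤ) ≤ |(k : ℤ) - l| →
      ‖discR p k l (hdot (W a) (W b))‖ ≤ ε := by
  have h : ∀ j : J × J, ∃ D : ℕ, j.1 ≠ j.2 → ∀ k l : ℕ, (D : ℤ) ≤ |(k : ℤ) - l| →
      ‖discR p k l (hdot (W j.1) (W j.2))‖ ≤ ε := by
    intro j
    by_cases hj : j.1 = j.2
    · exact ⟨0, fun h => absurd hj h⟩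
    · obtain ⟨D, hD⟩ := norm_discR_small hp (hW _ _ hj) hε
      exact ⟨D, fun _ => hD⟩
  choose D hD using h
  refine ⟨Finset.univ.sup D, fun a b hab k l hkl => hD (a, b) hab k l (le_trans ?_ hkl)⟩
  exact_mod_cast Finset.le_sup (f := D) (Finset.mem_univ (a, b))

lemma SPD_of_meetsAllProgressions {p : ℕ∞} (hp : 2 ≤ p) {f : ℂ → ℂ → ℂ} (hPD : PDonProd 1 p f)
    {a : ℤ × ℕ × ℕ → ℝ} (ha0 : ∀ i, 0 ≤ a i) (haS : Summable a)
    (hexp : ∀ ξ ∈ Metric.sphere (0 : ℂ) 1, ∀ η ∈ Metric.closedBall (0 : ℂ) 1,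
      f ξ η = ∑' i : ℤ × ℕ × ℕ, (a i : ℂ) * ξ ^ i.1 * discR p i.2.1 i.2.2 η)
    (hM : MeetsAllProgressions {v : ℤ × ℤ | ∃ (m : ℤ) (k l : ℕ), 0 < a (m, k, l) ∧
      v = (m, (k : ℤ) - (l : ℤ))}) :
    SPDonProd 1 p f := by
  refine ⟨hPD, fun L x hx hinj c h0 => ?_⟩
  by_contra hc
  obtain ⟨μ₀, hμ₀⟩ := Function.ne_iff.1 hc
  obtain ⟨J, _, _, g, W, u, hWΩ, hu, hW, hWlt⟩ :=
    exists_line_decomposition (fun μ => (x μ).2) fun μ => (hx μ).2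
  have : Nonempty J := ⟨g μ₀⟩
  have hcard : (0 : ℝ) < Fintype.card J := by exact_mod_cast Fintype.card_pos
  obtain ⟨D, hD⟩ := exists_uniform_decay hp W hWlt
    (ε := 1 / (2 * Fintype.card J)) (by positivity)
  set C : ℤ → ℤ → J → ℂ := fun m d b => ∑ μ with g μ = b, c μ * (x μ).1 0 ^ m * u μ ^ d with hC
  have hCsub : ∀ m d, C m d (g μ₀) =
      ∑ μ : {μ // g μ = g μ₀}, c μ * (x μ).1 0 ^ m * u μ ^ d := fun m d =>
    Finset.sum_subtype _ (by simp) _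
  have hz0 : ∀ μ, (x μ).1 0 ≠ 0 := fun μ h => by
    simpa [h] using norm_apply_zero_of_mem_Omega_one (hx μ).1
  have hu0 : ∀ μ, u μ ≠ 0 := fun μ h => by simpa [h] using hu μ
  obtain ⟨m₀, d₀, hmd⟩ := exists_expSum_ne_zero (fun μ : {μ // g μ = g μ₀} => c μ)
    (fun μ => (x μ).1 0) (fun μ => u μ) (fun μ => hz0 μ) (fun μ => hu0 μ) (by
      rintro ⟨μ, hμ⟩ ⟨ν, hν⟩ h
      simp only [Prod.mk.injEq] at h
      refine Subtype.ext (hinj (Prod.ext ?_ ?_))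
      · exact eq_of_mem_Omega_one (hx μ).1 (hx ν).1 h.1
      · have h1 := hW μ
        have h2 := hW ν
        rw [hμ, h.2] at h1
        rw [hν] at h2
        exact h1.trans h2.symm)
    (Function.ne_iff.2 ⟨⟨μ₀, rfl⟩, hμ₀⟩)
  obtain ⟨q, hq, hqne⟩ := exists_period_expSum_ne_zero _ _ _ (fun μ : {μ // g μ = g μ₀} => hz0 μ)
    (fun μ => hu0 μ) m₀ d₀ hmd
  set N : ℕ := q * (2 * D + 2) with hN
  have hNpos : 0 < N := by positivity
  have : NeZero N := ⟨hNpos.ne'⟩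
  set X : ℤ := m₀ % N + N
  set Y : ℤ := d₀ % q + q * D + N
  have hsum := hasSum_residue_class_zero hp hPD ha0 haS hexp x hx c h0 (X : ZMod N) (Y : ZMod N)
  have hclass : ∀ i : ℤ × ℕ × ℕ,
      (i.1 : ZMod N) = X ∧ (((i.2.1 : ℤ) - i.2.2 : ℤ) : ZMod N) = Y →
        C i.1 ((i.2.1 : ℤ) - i.2.2) (g μ₀) ≠ 0 ∧
        1 / 2 * ∑ b, ‖C i.1 ((i.2.1 : ℤ) - i.2.2) b‖ ^ 2 ≤ (kform p i x c).re := by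
    rintro ⟨m, k, l⟩ ⟨hm, hd⟩
    have hm' := (ZMod.intCast_eq_intCast_iff_dvd_sub _ _ _).1 hm.symm
    obtain ⟨hDd, hqd⟩ := le_abs_and_dvd_sub hq
      ((ZMod.intCast_eq_intCast_iff_dvd_sub _ _ _).1 hd.symm)
    have hqm : (q : ℤ) ∣ m - m₀ := by
      refine Dvd.dvd.trans (b := (N : ℤ)) ⟨2 * D + 2, by rw [hN]; push_cast; ring⟩ ?_
      obtain ⟨t, ht⟩ := hm'
      exact ⟨t + 1 - m₀ / N, by linear_combination ht + Int.emod_add_mul_ediv m₀ N⟩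
    refine ⟨?_, ?_⟩
    · rw [hCsub]; exact hqne _ _ hqm hqd
    · rw [kform_eq_sum_fiber _ x (fun μ => (hx μ).1) c g W u hu hW]
      refine half_sum_sq_le_re_of_offDiag_small (C m ((k : ℤ) - l))
        (fun a b => discR p k l (hdot (W a) (W b))) (fun a => ?_) (ε := 1 / (2 * Fintype.card J))
        (by positivity) (by field_simp; rfl) fun a b hab => hD a b hab k l hDd
      rw [hdot_self (hWΩ a), discR_one]
  have hre := Complex.hasSum_re hsum
  have hnn : ∀ i : ℤ × ℕ × ℕ, 0 ≤ ((a i : ℂ) *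
      if (i.1 : ZMod N) = X ∧ (((i.2.1 : ℤ) - i.2.2 : ℤ) : ZMod N) = Y then
        kform p i x c else 0).re := by
    intro i
    rw [Complex.re_ofReal_mul]
    refine mul_nonneg (ha0 i) ?_
    split_ifs with h
    · exact le_trans (by positivity) (hclass i h).2
    · simp
  have hNZ : (0 : ℤ) < N := by exact_mod_cast hNpos
  have hX : 0 < X := add_pos_of_nonneg_of_pos (Int.emod_nonneg _ hNZ.ne') hNZ
  have hY : 0 < Y := add_pos_of_nonneg_of_pos
    (add_nonneg (Int.emod_nonneg _ (by exact_mod_cast hq.ne')) (by positivity)) hNZ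
  obtain ⟨v, ⟨m, k, l, hpos, rfl⟩, ⟨s, hs⟩, ⟨t, ht⟩⟩ := hM N N X Y hNZ hNZ hX hY
  have hmem : (m : ZMod N) = X ∧ (((k : ℤ) - l : ℤ) : ZMod N) = Y := by
    simp only at hs ht
    constructor
    · rw [hs]; simp
    · rw [ht]; simp
  have hz := congrFun ((hasSum_zero_iff_of_nonneg hnn).1 hre) (m, k, l)
  obtain ⟨hne, hle⟩ := hclass (m, k, l) hmem
  simp only [if_pos hmem, Complex.re_ofReal_mul, Pi.zero_apply, mul_eq_zero, hpos.ne',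
    false_or] at hz
  have hsingle := Finset.single_le_sum (f := fun b => ‖C m ((k : ℤ) - l) b‖ ^ 2)
    (fun b _ => by positivity) (Finset.mem_univ (g μ₀))
  have : 0 < ‖C m ((k : ℤ) - l) (g μ₀)‖ ^ 2 := by
    have := norm_pos_iff.2 hne
    positivity
  simp only at hsingle hle
  linarith

/-- Theorem 1.2 / `th_main_1p`: for `2 ≤ p ∈ ℕ ∪ {∞}`,
a continuous PD function on `Ω_2 × Ω_{2p}` is SPD if and only if the set
`{(m, k-l) : a_{m,k,l} > 0}` from its expansion intersects every product of full
arithmetic progressions in ℤ. -/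
theorem stmt1 (p : ℕ∞) (hp : 2 ≤ p) (f : ℂ → ℂ → ℂ)
    (hf : ContinuousOn (fun v : ℂ × ℂ => f v.1 v.2)
      (Metric.sphere 0 1 ×ˢ Metric.closedBall 0 1))
    (hPD : PDonProd 1 p f)
    (a : ℤ × ℕ × ℕ → ℝ) (ha0 : ∀ i, 0 ≤ a i) (haS : Summable a)
    (hexp : ∀ ξ ∈ Metric.sphere (0 : ℂ) 1, ∀ η ∈ Metric.closedBall (0 : ℂ) 1,
      f ξ η = ∑' i : ℤ × ℕ × ℕ,
        (a i : ℂ) * ξ ^ i.1 * discR p i.2.1 i.2.2 η) :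
    SPDonProd 1 p f ↔
      MeetsAllProgressions
        {v : ℤ × ℤ | ∃ (m : ℤ) (k l : ℕ), 0 < a (m, k, l) ∧
          v = (m, (k : ℤ) - (l : ℤ))} :=
  ⟨meetsAllProgressions_of_SPD hp ha0 haS hexp, SPD_of_meetsAllProgressions hp hPD ha0 haS hexp⟩

end
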